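/- Assume p = 3. Every homomorphism of algebraic groups σ : SL(2,k) → SL(4,k) is equivalent to exactly one homomorphism in the following list; in particular, any two distinct members of the list (belonging to different items, or to the same item with different parameter values) are inequivalent. Writing A = [[a,b],[c,d]] ∈ SL(2,k) and q = 3^e: (II) for each integer e ≥ 0, the map A ↦ [[a^{3q}, b^{3q}, a^{2q}b^{q}, (1/2)a^{q}b^{2q}], [c^{3q}, d^{3q}, c^{2q}d^{q}, (1/2)c^{q}d^{2q}], [0, 0, a^{q}, b^{q}], [0, 0, c^{q}, d^{q}]]; (IV) for each pair of integers e₂ > e₁ ≥ 0, the map A ↦ A^{(3^{e₂})} ⊗ A^{(3^{e₁})}; (VII) for each integer e ≥ 0, the map A ↦ [[a^{q}, b^{q}, (1/2)a^{2q}c^{q}, (1/2)b^{2q}d^{q}], [c^{q}, d^{q}, a^{q}c^{2q}, b^{q}d^{2q}], [0, 0, a^{3q}, b^{3q}], [0, 0, c^{3q}, d^{3q}]]; (IX) for each integer e ≥ 0, the block-diagonal map A ↦ diag(M(A), 1) where M(A) = [[a^{2q}, a^{q}b^{q}, b^{2q}], [2a^{q}c^{q}, a^{q}d^{q}+b^{q}c^{q},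 2b^{q}d^{q}], [c^{2q}, c^{q}d^{q}, d^{2q}]]; (XV) for each pair of integers e₂ ≥ e₃ ≥ 0, the block-diagonal map A ↦ diag(A^{(3^{e₂})}, A^{(3^{e₃})}); (XXIV) for each integer e ≥ 0, the block-diagonal map A ↦ diag(A^{(3^{e})}, 1, 1); (XXVI) the constant map A ↦ I₄. -/

import Mathlib

open Matrix

/-- Entrywise `m`-th power of a 2×2 matrix: `A^{(m)} = [[a^m, b^m],[c^m, d^m]]`. -/
noncomputable def entryPow {k : Type*} [Field k] (A : Matrix (Fin 2) (Fin 2) k) (m : ℕ) :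
    Matrix (Fin 2) (Fin 2) k :=
  Matrix.of fun i j => A i j ^ m

/-- The Kronecker product of two 2×2 matrices as a 4×4 matrix in 2×2 blocks. -/
noncomputable def kron4 {k : Type*} [Field k] (X Y : Matrix (Fin 2) (Fin 2) k) :
    Matrix (Fin 4) (Fin 4) k :=
  !![X 0 0 * Y 0 0, X 0 0 * Y 0 1, X 0 1 * Y 0 0, X 0 1 * Y 0 1;
     X 0 0 * Y 1 0, X 0 0 * Y 1 1, X 0 1 * Y 1 0, X 0 1 * Y 1 1;
     X 1 0 * Y 0 0, X 1 0 * Y 0 1, X 1 1 * Y 0 0, X 1 1 * Y 0 1;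
     X 1 0 * Y 1 0, X 1 0 * Y 1 1, X 1 1 * Y 1 0, X 1 1 * Y 1 1]

/-- The block-diagonal 4×4 matrix `diag(X, Y)` built from two 2×2 matrices. -/
noncomputable def blockDiag4 {k : Type*} [Field k] (X Y : Matrix (Fin 2) (Fin 2) k) :
    Matrix (Fin 4) (Fin 4) k :=
  !![X 0 0, X 0 1, 0, 0;
     X 1 0, X 1 1, 0, 0;
     0, 0, Y 0 0, Y 0 1;
     0, 0, Y 1 0, Y 1 1]

/-- Family (II) (for `p = 3`). -/
noncomputable def famII (k : Type*) [Field k] (q : ℕ)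
    (A : SpecialLinearGroup (Fin 2) k) : Matrix (Fin 4) (Fin 4) k :=
  let a := A.1 0 0
  let b := A.1 0 1
  let c := A.1 1 0
  let d := A.1 1 1
  !![a ^ (3 * q), b ^ (3 * q), a ^ (2 * q) * b ^ q, (1 / 2 : k) * (a ^ q * b ^ (2 * q));
     c ^ (3 * q), d ^ (3 * q), c ^ (2 * q) * d ^ q, (1 / 2 : k) * (c ^ q * d ^ (2 * q));
     0, 0, a ^ q, b ^ q;
     0, 0, c ^ q, d ^ q]

/-- Family (VII) (for `p = 3`). -/
noncomputable def famVII (k : Type*) [Field k] (q : ℕ)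
    (A : SpecialLinearGroup (Fin 2) k) : Matrix (Fin 4) (Fin 4) k :=
  let a := A.1 0 0
  let b := A.1 0 1
  let c := A.1 1 0
  let d := A.1 1 1
  !![a ^ q, b ^ q, (1 / 2 : k) * (a ^ (2 * q) * c ^ q), (1 / 2 : k) * (b ^ (2 * q) * d ^ q);
     c ^ q, d ^ q, a ^ q * c ^ (2 * q), b ^ q * d ^ (2 * q);
     0, 0, a ^ (3 * q), b ^ (3 * q);
     0, 0, c ^ (3 * q), d ^ (3 * q)]

/-- Family (IX): the twisted adjoint representation plus a trivial summand. -/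
noncomputable def famIX (k : Type*) [Field k] (q : ℕ)
    (A : SpecialLinearGroup (Fin 2) k) : Matrix (Fin 4) (Fin 4) k :=
  let a := A.1 0 0
  let b := A.1 0 1
  let c := A.1 1 0
  let d := A.1 1 1
  !![a ^ (2 * q), a ^ q * b ^ q, b ^ (2 * q), 0;
     2 * (a ^ q * c ^ q), a ^ q * d ^ q + b ^ q * c ^ q, 2 * (b ^ q * d ^ q), 0;
     c ^ (2 * q), c ^ q * d ^ q, d ^ (2 * q), 0;
     0, 0, 0, 1]

/-- Entrywise polynomial condition: each matrix entry of `σ(A)` is a fixed polynomial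
in the four entries of `A`. -/
def IsPolyEntries {k : Type*} [Field k]
    (σ : SpecialLinearGroup (Fin 2) k → Matrix (Fin 4) (Fin 4) k) : Prop :=
  ∀ i j : Fin 4, ∃ P : MvPolynomial (Fin 2 × Fin 2) k,
    ∀ A : SpecialLinearGroup (Fin 2) k,
      σ A i j = MvPolynomial.eval (fun x => A.1 x.1 x.2) P

/-- Equivalence of matrix-valued maps on `SL(2,k)`: conjugacy by some `P ∈ GL(4,k)`. -/
def MatEquiv {k : Type*} [Field k]
    (f g : SpecialLinearGroup (Fin 2) k → Matrix (Fin 4) (Fin 4) k) : Prop :=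
  ∃ P : GL (Fin 4) k, ∀ A : SpecialLinearGroup (Fin 2) k,
    ((P⁻¹ : GL (Fin 4) k) : Matrix (Fin 4) (Fin 4) k) * f A *
      (P : Matrix (Fin 4) (Fin 4) k) = g A

/-- The index set of the classification list for `p = 3`. -/
inductive Idx14 : Type
  | II : ℕ → Idx14
  | IV : (e₁ e₂ : ℕ) → e₁ < e₂ → Idx14
  | VII : ℕ → Idx14
  | IX : ℕ → Idx14
  | XV : (e₂ e₃ : ℕ) → e₃ ≤ e₂ → Idx14
  | XXIV : ℕ → Idx14
  | XXVI : Idx14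

/-- The classification list of homomorphisms `SL(2,k) → SL(4,k)` for `p = 3`. -/
noncomputable def list14 {k : Type*} [Field k] (p : ℕ) :
    Idx14 → SpecialLinearGroup (Fin 2) k → Matrix (Fin 4) (Fin 4) k
  | Idx14.II e => famII k (p ^ e)
  | Idx14.IV e₁ e₂ _ => fun A => kron4 (entryPow A.1 (p ^ e₂)) (entryPow A.1 (p ^ e₁))
  | Idx14.VII e => famVII k (p ^ e)
  | Idx14.IX e => famIX k (p ^ e)
  | Idx14.XV e₂ e₃ _ => fun A => blockDiag4 (entryPow A.1 (p ^ e₂)) (entryPow A.1 (p ^ e₃))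
  | Idx14.XXIV e => fun A => blockDiag4 (entryPow A.1 (p ^ e)) 1
  | Idx14.XXVI => fun _ => 1

section VectorPolynomials
variable {k V : Type*} [Field k] [AddCommGroup V] [Module k V]

/-- Coefficients of vector-valued polynomial functions agreeing away from zero coincide. -/
theorem sum_filter_eq_of_pow_smul_eq [Infinite k] {ι κ : Type*} (S : Finset ι) (T : Finset κ)
    (e : ι → ℕ) (f : κ → ℕ) (x : ι → V) (y : κ → V)
    (h : ∀ t : k, t ≠ 0 → ∑ i ∈ S, t ^ e i • x i = ∑ j ∈ T, t ^ f j • y j) (n : ℕ) :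
    ∑ i ∈ S with e i = n, x i = ∑ j ∈ T with f j = n, y j := by
  rw [← sub_eq_zero, ← Module.forall_dual_apply_eq_zero_iff k]
  intro φ
  have hp : ∑ i ∈ S, Polynomial.monomial (e i) (φ (x i)) =
      ∑ j ∈ T, Polynomial.monomial (f j) (φ (y j)) := by
    refine Polynomial.eq_of_infinite_eval_eq _ _ ?_
    refine Set.Infinite.mono (s := {0}ᶜ) ?_ (Set.finite_singleton (0 : k)).infinite_compl
    intro t ht
    have := congrArg φ (h t ht)
    simp only [map_sum, map_smul, smul_eq_mul] at this
    simpa [Polynomial.eval_finsetSum, mul_comm] using this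
  have := congrArg (fun p => Polynomial.coeff p n) hp
  simp only [Polynomial.finsetSum_coeff, Polynomial.coeff_monomial] at this
  rw [map_sub, map_sum, map_sum, Finset.sum_filter, Finset.sum_filter, this, sub_self]

theorem eq_of_sum_range_pow_smul_eq [Infinite k] {n : ℕ} {x y : ℕ → V}
    (h : ∀ t : k, t ≠ 0 → ∑ i ∈ Finset.range n, t ^ i • x i = ∑ i ∈ Finset.range n, t ^ i • y i)
    {j : ℕ} (hj : j < n) : x j = y j := by
  have := sum_filter_eq_of_pow_smul_eq _ _ _ _ _ _ h j
  simpa [Finset.sum_filter, hj] using this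

theorem eq_zero_of_sum_pow_smul_eq_zero [Infinite k] {ι : Type*} {S : Finset ι} {e : ι → ℕ}
    (he : Set.InjOn e S) {x : ι → V} (h : ∀ t : k, t ≠ 0 → ∑ i ∈ S, t ^ e i • x i = 0)
    {j : ι} (hj : j ∈ S) : x j = 0 := by
  have := sum_filter_eq_of_pow_smul_eq S (∅ : Finset ℕ) e id x (fun _ => 0) (by simpa using h) (e j)
  rw [Finset.sum_eq_single j] at this
  · simpa using this
  · intro b hb hne
    simp only [Finset.mem_filter] at hb
    exact absurd (he hb.1 hj hb.2) hne
  · intro hn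
    simp [hj] at hn

end VectorPolynomials

section SLTwo
variable {k : Type*} [Field k]

/-- The upper unitriangular elements of `SL(2,k)`. -/
def upperSL (s : k) : SpecialLinearGroup (Fin 2) k := ⟨!![1, s; 0, 1], by simp⟩

/-- The lower unitriangular elements of `SL(2,k)`. -/
def lowerSL (s : k) : SpecialLinearGroup (Fin 2) k := ⟨!![1, 0; s, 1], by simp⟩

/-- The diagonal elements of `SL(2,k)`. -/
def torusSL (t : k) (ht : t ≠ 0) : SpecialLinearGroup (Fin 2) k :=
  ⟨!![t, 0; 0, t⁻¹], by simp [ht]⟩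

/-- The standard Weyl element of `SL(2,k)`. -/
def weylSL (k : Type*) [Field k] : SpecialLinearGroup (Fin 2) k := ⟨!![0, -1; 1, 0], by simp⟩

theorem SLTwo.ext_entries {A B : SpecialLinearGroup (Fin 2) k} (h₀₀ : A.1 0 0 = B.1 0 0)
    (h₀₁ : A.1 0 1 = B.1 0 1) (h₁₀ : A.1 1 0 = B.1 1 0) (h₁₁ : A.1 1 1 = B.1 1 1) : A = B := by
  apply Subtype.ext
  ext i j
  fin_cases i <;> fin_cases j <;> assumption

theorem SLTwo.det_eq (A : SpecialLinearGroup (Fin 2) k) :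
    A.1 0 0 * A.1 1 1 - A.1 0 1 * A.1 1 0 = 1 := by
  rw [← Matrix.det_fin_two]; exact A.2

theorem SLTwo.mul_entry (A B : SpecialLinearGroup (Fin 2) k) (i j : Fin 2) :
    (A * B).1 i j = A.1 i 0 * B.1 0 j + A.1 i 1 * B.1 1 j := by
  change (A.1 * B.1) i j = _
  rw [Matrix.mul_apply, Fin.sum_univ_two]

theorem upperSL_val (s : k) : (upperSL s).1 = !![1, s; 0, 1] := rfl

theorem lowerSL_val (s : k) : (lowerSL s).1 = !![1, 0; s, 1] := rfl

theorem torusSL_val (t : k) (ht : t ≠ 0) : (torusSL t ht).1 = !![t, 0; 0, t⁻¹] := rfl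

theorem weylSL_val : (weylSL k).1 = !![0, -1; 1, 0] := rfl

theorem upperSL_zero : upperSL (0 : k) = 1 := by
  apply SLTwo.ext_entries <;> simp [upperSL_val]

theorem lowerSL_zero : lowerSL (0 : k) = 1 := by
  apply SLTwo.ext_entries <;> simp [lowerSL_val]

theorem torusSL_one : torusSL (1 : k) one_ne_zero = 1 := by
  apply SLTwo.ext_entries <;> simp [torusSL_val]

theorem transpose_upperSL (s : k) : (upperSL s).transpose = lowerSL s := by
  apply SLTwo.ext_entries <;> simp [lowerSL_val, upperSL_val, SpecialLinearGroup.transpose]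

theorem transpose_torusSL (t : k) (ht : t ≠ 0) : (torusSL t ht).transpose = torusSL t ht := by
  apply SLTwo.ext_entries <;> simp [torusSL_val, SpecialLinearGroup.transpose]

theorem torusSL_mul (s t : k) (hs : s ≠ 0) (ht : t ≠ 0) :
    torusSL s hs * torusSL t ht = torusSL (s * t) (mul_ne_zero hs ht) := by
  apply SLTwo.ext_entries <;> simp [torusSL_val, SLTwo.mul_entry, mul_comm]

theorem torusSL_mul_upperSL (t s : k) (ht : t ≠ 0) :
    torusSL t ht * upperSL s = upperSL (t ^ 2 * s) * torusSL t ht := by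
  apply SLTwo.ext_entries <;> simp [torusSL_val, upperSL_val, SLTwo.mul_entry]
  field_simp

theorem lowerSL_mul_torusSL (t s : k) (ht : t ≠ 0) :
    lowerSL s * torusSL t ht = torusSL t ht * lowerSL (t ^ 2 * s) := by
  apply SLTwo.ext_entries <;> simp [torusSL_val, lowerSL_val, SLTwo.mul_entry]
  field_simp

theorem weylSL_mul_torusSL (t : k) (ht : t ≠ 0) :
    weylSL k * torusSL t ht = torusSL t⁻¹ (inv_ne_zero ht) * weylSL k := by
  apply SLTwo.ext_entries <;> simp [torusSL_val, weylSL_val, SLTwo.mul_entry]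

theorem eq_upperSL_mul_lowerSL_mul_upperSL (A : SpecialLinearGroup (Fin 2) k)
    (hc : A.1 1 0 ≠ 0) :
    A = upperSL ((A.1 0 0 - 1) / A.1 1 0) * lowerSL (A.1 1 0) *
      upperSL ((A.1 1 1 - 1) / A.1 1 0) := by
  have hdet := SLTwo.det_eq A
  apply SLTwo.ext_entries <;> simp [upperSL_val, lowerSL_val, SLTwo.mul_entry] <;> field_simp
  · ring
  · linear_combination -hdet
  · ring

/-- A homomorphism from `SL(2,k)` is trivial once it is trivial on unitriangular elements. -/
theorem eq_one_of_unitriangular {M : Type*} [Monoid M] (ρ : SpecialLinearGroup (Fin 2) k →* M)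
    (hu : ∀ s, ρ (upperSL s) = 1) (hl : ∀ s, ρ (lowerSL s) = 1)
    (A : SpecialLinearGroup (Fin 2) k) : ρ A = 1 := by
  have key : ∀ B : SpecialLinearGroup (Fin 2) k, B.1 1 0 ≠ 0 → ρ B = 1 := by
    intro B hB
    rw [eq_upperSL_mul_lowerSL_mul_upperSL B hB]
    simp [hu, hl]
  by_cases hc : A.1 1 0 = 0
  · have ha : A.1 0 0 ≠ 0 := by
      intro ha
      have := SLTwo.det_eq A
      simp [ha, hc] at this
    have h := key (lowerSL 1 * A) (by simpa [lowerSL_val, SLTwo.mul_entry, hc] using ha)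
    simpa [hl] using h
  · exact key A hc

theorem eq_lowerSL_mul_torusSL_mul_upperSL (A : SpecialLinearGroup (Fin 2) k)
    (ha : A.1 0 0 ≠ 0) :
    A = lowerSL (A.1 1 0 / A.1 0 0) * torusSL (A.1 0 0) ha * upperSL (A.1 0 1 / A.1 0 0) := by
  have hdet := SLTwo.det_eq A
  apply SLTwo.ext_entries <;>
    simp [upperSL_val, lowerSL_val, torusSL_val, SLTwo.mul_entry] <;> field_simp
  linear_combination hdet

theorem eq_weylSL_mul_torusSL_mul_upperSL (A : SpecialLinearGroup (Fin 2) k)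
    (ha : A.1 0 0 = 0) (hc : A.1 1 0 ≠ 0) :
    A = weylSL k * torusSL (A.1 1 0) hc * upperSL (A.1 1 1 / A.1 1 0) := by
  have hdet := SLTwo.det_eq A
  apply SLTwo.ext_entries <;>
    simp [upperSL_val, weylSL_val, torusSL_val, SLTwo.mul_entry, ha] <;> field_simp
  simp only [ha] at hdet
  linear_combination -hdet

theorem exists_SL_first_column (x y : k) (h : x ≠ 0 ∨ y ≠ 0) :
    ∃ B : SpecialLinearGroup (Fin 2) k, B.1 0 0 = x ∧ B.1 1 0 = y := by
  by_cases hx : x = 0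
  · have hy : y ≠ 0 := by tauto
    exact ⟨⟨!![x, -y⁻¹; y, 0], by simp [hy]⟩, by simp, by simp⟩
  · exact ⟨⟨!![x, 0; y, x⁻¹], by simp [hx]⟩, by simp, by simp⟩

end SLTwo

section Regular
variable {k V W : Type*} [Field k] [AddCommGroup V] [Module k V] [AddCommGroup W] [Module k W]

/-- A vector-valued function on `SL(2,k)` is regular if it is a combination of fixed vectors with
coefficients polynomial in the matrix entries. -/
def IsRegularMap (g : SpecialLinearGroup (Fin 2) k → V) : Prop :=
  ∃ (ι : Type) (_ : Fintype ι) (P : ι → MvPolynomial (Fin 2 × Fin 2) k) (x : ι → V),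
    ∀ A, g A = ∑ i, MvPolynomial.eval (fun z => A.1 z.1 z.2) (P i) • x i

theorem IsRegularMap.map {g : SpecialLinearGroup (Fin 2) k → V} (hg : IsRegularMap g)
    (L : V →ₗ[k] W) :
    IsRegularMap fun A => L (g A) := by
  obtain ⟨ι, hι, P, x, h⟩ := hg
  exact ⟨ι, hι, P, fun i => L (x i), fun A => by simp [h]⟩

theorem IsRegularMap.comp_transpose {g : SpecialLinearGroup (Fin 2) k → V} (hg : IsRegularMap g) :
    IsRegularMap fun A => g A.transpose := by
  obtain ⟨ι, hι, P, x, h⟩ := hg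
  refine ⟨ι, hι, fun i => MvPolynomial.rename Prod.swap (P i), x, fun A => ?_⟩
  simp only [h, MvPolynomial.eval_rename]
  rfl

theorem exists_sum_range_of_sum_eval {ι : Type*} [Fintype ι] (Q : ι → Polynomial k) (x : ι → V) :
    ∃ (M : ℕ) (c : ℕ → V), ∀ t : k,
      ∑ i, (Q i).eval t • x i = ∑ j ∈ Finset.range M, t ^ j • c j := by
  refine ⟨(Finset.univ.sup fun i => (Q i).natDegree) + 1, fun j => ∑ i, (Q i).coeff j • x i, ?_⟩
  intro t
  simp only [Finset.smul_sum]
  rw [Finset.sum_comm]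
  refine Finset.sum_congr rfl fun i _ => ?_
  rw [Polynomial.eval_eq_sum_range' (Nat.lt_succ_of_le
      (Finset.le_sup (f := fun i => (Q i).natDegree) (Finset.mem_univ i))),
    Finset.sum_smul]
  refine Finset.sum_congr rfl fun j _ => ?_
  rw [smul_smul, mul_comm]

theorem IsRegularMap.exists_polynomial {g : SpecialLinearGroup (Fin 2) k → V} (hg : IsRegularMap g)
    (α : Fin 2 × Fin 2 → Polynomial k) :
    ∃ (M : ℕ) (c : ℕ → V), ∀ (t : k) (A : SpecialLinearGroup (Fin 2) k),
      (∀ z, A.1 z.1 z.2 = (α z).eval t) → g A = ∑ j ∈ Finset.range M, t ^ j • c j := by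
  obtain ⟨ι, hι, P, x, h⟩ := hg
  obtain ⟨M, c, hc⟩ := exists_sum_range_of_sum_eval (fun i => MvPolynomial.aeval α (P i)) x
  refine ⟨M, c, fun t A hA => ?_⟩
  rw [h, ← hc]
  refine Finset.sum_congr rfl fun i _ => ?_
  congr 1
  have : (fun z : Fin 2 × Fin 2 => A.1 z.1 z.2) = fun z => (α z).eval t := funext hA
  rw [this]
  induction P i using MvPolynomial.induction_on with
  | C a => simp
  | add p q hp hq => simp [hp, hq]
  | mul_X p z hp => simp [hp]

theorem exists_laurent_eval (P : MvPolynomial (Fin 2 × Fin 2) k)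
    (α : Fin 2 × Fin 2 → Polynomial k) :
    ∃ (N : ℕ) (Q : Polynomial k), ∀ (t : k) (A : SpecialLinearGroup (Fin 2) k),
      (∀ z, t * A.1 z.1 z.2 = (α z).eval t) →
        t ^ N * MvPolynomial.eval (fun z => A.1 z.1 z.2) P = Q.eval t := by
  induction P using MvPolynomial.induction_on with
  | C a => exact ⟨0, Polynomial.C a, by simp⟩
  | add p q hp hq =>
    obtain ⟨N, Q, h⟩ := hp
    obtain ⟨N', Q', h'⟩ := hq
    refine ⟨N + N', Polynomial.X ^ N' * Q + Polynomial.X ^ N * Q', fun t A hA => ?_⟩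
    simp only [map_add, Polynomial.eval_add, Polynomial.eval_mul, Polynomial.eval_pow,
      Polynomial.eval_X, ← h t A hA, ← h' t A hA]
    ring
  | mul_X p z hp =>
    obtain ⟨N, Q, h⟩ := hp
    refine ⟨N + 1, Q * α z, fun t A hA => ?_⟩
    simp only [map_mul, MvPolynomial.eval_X, Polynomial.eval_mul, ← h t A hA, ← hA z]
    ring

theorem IsRegularMap.exists_laurent {g : SpecialLinearGroup (Fin 2) k → V} (hg : IsRegularMap g)
    (α : Fin 2 × Fin 2 → Polynomial k) :
    ∃ (N M : ℕ) (c : ℕ → V), ∀ (t : k) (A : SpecialLinearGroup (Fin 2) k),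
      (∀ z, t * A.1 z.1 z.2 = (α z).eval t) →
        t ^ N • g A = ∑ j ∈ Finset.range M, t ^ j • c j := by
  obtain ⟨ι, hι, P, x, h⟩ := hg
  choose N Q hQ using fun i => exists_laurent_eval (P i) α
  obtain ⟨M, c, hc⟩ := exists_sum_range_of_sum_eval
    (fun i => Polynomial.X ^ ((Finset.univ.sup N) - N i) * Q i) x
  refine ⟨Finset.univ.sup N, M, c, fun t A hA => ?_⟩
  rw [h, ← hc, Finset.smul_sum]
  refine Finset.sum_congr rfl fun i _ => ?_
  have hle : N i ≤ Finset.univ.sup N := Finset.le_sup (Finset.mem_univ i)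
  rw [smul_smul, Polynomial.eval_mul, ← hQ i t A hA, Polynomial.eval_pow, Polynomial.eval_X,
    ← mul_assoc, ← pow_add, Nat.sub_add_cancel hle]

theorem IsRegularMap.exists_upper {g : SpecialLinearGroup (Fin 2) k → V} (hg : IsRegularMap g) :
    ∃ (M : ℕ) (c : ℕ → V), ∀ s, g (upperSL s) = ∑ j ∈ Finset.range M, s ^ j • c j := by
  obtain ⟨M, c, h⟩ := hg.exists_polynomial
    (fun z => !![1, Polynomial.X; 0, 1] z.1 z.2)
  refine ⟨M, c, fun s => h s _ ?_⟩
  rintro ⟨i, j⟩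
  fin_cases i <;> fin_cases j <;> simp [upperSL_val]

theorem IsRegularMap.exists_lower {g : SpecialLinearGroup (Fin 2) k → V} (hg : IsRegularMap g) :
    ∃ (M : ℕ) (c : ℕ → V), ∀ s, g (lowerSL s) = ∑ j ∈ Finset.range M, s ^ j • c j := by
  obtain ⟨M, c, h⟩ := hg.exists_polynomial
    (fun z => !![1, 0; Polynomial.X, 1] z.1 z.2)
  refine ⟨M, c, fun s => h s _ ?_⟩
  rintro ⟨i, j⟩
  fin_cases i <;> fin_cases j <;> simp [lowerSL_val]

end Regular

section TopWeight
variable {k E : Type*} [Field k] [Ring E] [Algebra k E]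
  {ρ : SpecialLinearGroup (Fin 2) k →* E}

/-- `H` lists the coefficients of `t ^ N • ρ (torusSL t)`, up to degree `D`. -/
def TorusExpansion (ρ : SpecialLinearGroup (Fin 2) k →* E) (N D : ℕ) (H : ℕ → E) : Prop :=
  ∀ (t : k) (ht : t ≠ 0),
    t ^ N • ρ (torusSL t ht) = ∑ i ∈ Finset.range (D + 1), t ^ i • H i

theorem exists_torusExpansion [Nontrivial E] (hρ : IsRegularMap (fun A => ρ A)) :
    ∃ (N D : ℕ) (H : ℕ → E), TorusExpansion ρ N D H ∧ H D ≠ 0 := by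
  obtain ⟨N, M, c, h⟩ := hρ.exists_laurent
    (fun z => !![Polynomial.X ^ 2, 0; 0, 1] z.1 z.2)
  have h' : ∀ (t : k) (ht : t ≠ 0),
      t ^ N • ρ (torusSL t ht) = ∑ i ∈ Finset.range M, t ^ i • c i := by
    refine fun t ht => h t _ ?_
    rintro ⟨i, j⟩
    fin_cases i <;> fin_cases j <;> simp [torusSL_val, ht, pow_two]
  clear h
  induction M with
  | zero =>
    have := h' 1 one_ne_zero
    simp [torusSL_one] at this
  | succ D ih =>
    by_cases hD : c D = 0
    · exact ih fun t ht => by rw [h' t ht, Finset.sum_range_succ, hD, smul_zero, add_zero]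
    · exact ⟨N, D, c, h', hD⟩

variable {N D : ℕ} {H : ℕ → E}

theorem TorusExpansion.top_mul_torus [Infinite k] (h : TorusExpansion ρ N D H)
    (s : k) (hs : s ≠ 0) : H D * (s ^ N • ρ (torusSL s hs)) = s ^ D • H D := by
  refine (eq_of_sum_range_pow_smul_eq (k := k) (n := D + 1)
    (x := fun i => H i * (s ^ N • ρ (torusSL s hs))) (y := fun i => s ^ i • H i) ?_
    (Nat.lt_succ_self D))
  intro t ht
  have h1 := h (t * s) (mul_ne_zero ht hs)
  rw [← torusSL_mul t s ht hs, map_mul, mul_pow] at h1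
  calc _ = (t ^ N • ρ (torusSL t ht)) * (s ^ N • ρ (torusSL s hs)) := by
        rw [h t ht, Finset.sum_mul]
        simp only [smul_mul_assoc]
    _ = _ := by
        rw [smul_mul_smul_comm, h1]
        simp only [mul_pow, smul_smul]

theorem TorusExpansion.torus_mul_top [Infinite k] (h : TorusExpansion ρ N D H)
    (s : k) (hs : s ≠ 0) : (s ^ N • ρ (torusSL s hs)) * H D = s ^ D • H D := by
  refine (eq_of_sum_range_pow_smul_eq (k := k) (n := D + 1)
    (x := fun i => (s ^ N • ρ (torusSL s hs)) * H i) (y := fun i => s ^ i • H i) ?_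
    (Nat.lt_succ_self D))
  intro t ht
  have h1 := h (s * t) (mul_ne_zero hs ht)
  rw [← torusSL_mul s t hs ht, map_mul, mul_pow] at h1
  calc _ = (s ^ N • ρ (torusSL s hs)) * (t ^ N • ρ (torusSL t ht)) := by
        rw [h t ht, Finset.mul_sum]
        simp only [mul_smul_comm]
    _ = _ := by
        rw [smul_mul_smul_comm, h1]
        simp only [mul_pow, smul_smul, mul_comm]

/-- If conjugating by the torus only raises degrees, no positive degree can occur. -/
theorem eq_of_degree_bound [Infinite k] {V : Type*} [AddCommGroup V] [Module k V]
    {M D : ℕ} {c d : ℕ → V}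
    (h : ∀ t : k, t ≠ 0 → ∑ i ∈ Finset.range (D + 1), t ^ i • d i =
      ∑ j ∈ Finset.range M, t ^ (D + 2 * j) • c j) {j : ℕ} (hj : 0 < j) (hM : j < M) :
    c j = 0 := by
  have := sum_filter_eq_of_pow_smul_eq _ _ _ _ _ _ h (D + 2 * j)
  rw [Finset.filter_false_of_mem, Finset.sum_empty, Finset.sum_eq_single j] at this
  · exact this.symm
  · intro i hi hne
    simp only [Finset.mem_filter] at hi
    omega
  · intro hn
    simp [hM] at hn
  · intro i hi
    simp only [Finset.mem_range] at hi
    omega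

theorem sum_range_eq_of_forall_pos_eq_zero {V : Type*} [AddCommGroup V] [Module k V]
    {M : ℕ} {c : ℕ → V} (h : ∀ j, 0 < j → j < M → c j = 0) (s : k) :
    ∑ j ∈ Finset.range M, s ^ j • c j = ∑ j ∈ Finset.range M, (0 : k) ^ j • c j := by
  refine Finset.sum_congr rfl fun j hj => ?_
  rcases Nat.eq_zero_or_pos j with rfl | hpos
  · simp
  · simp [h j hpos (Finset.mem_range.1 hj)]

theorem TorusExpansion.upper_mul_top [Infinite k] (h : TorusExpansion ρ N D H)
    (hρ : IsRegularMap (fun A => ρ A)) (s : k) : ρ (upperSL s) * H D = H D := by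
  obtain ⟨M, c, hc⟩ := (hρ.map (LinearMap.mulRight k (H D))).exists_upper
  simp only [LinearMap.mulRight_apply] at hc
  have hz : ∀ j, 0 < j → j < M → c j = 0 := by
    intro j
    refine eq_of_degree_bound (k := k) (D := D) (d := fun i => H i * (ρ (upperSL 1) * H D)) ?_
    intro t ht
    calc _ = (t ^ N • ρ (torusSL t ht)) * (ρ (upperSL 1) * H D) := by
          rw [h t ht, Finset.sum_mul]
          simp only [smul_mul_assoc]
      _ = ρ (upperSL (t ^ 2)) * ((t ^ N • ρ (torusSL t ht)) * H D) := by
          rw [← mul_assoc, smul_mul_assoc, ← map_mul, torusSL_mul_upperSL, mul_one, map_mul,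
            ← mul_assoc, mul_smul_comm]
      _ = t ^ D • (ρ (upperSL (t ^ 2)) * H D) := by
          rw [h.torus_mul_top t ht, mul_smul_comm]
      _ = _ := by
          rw [hc, Finset.smul_sum]
          refine Finset.sum_congr rfl fun i _ => ?_
          rw [smul_smul]
          ring_nf
  rw [hc, sum_range_eq_of_forall_pos_eq_zero hz, ← hc, upperSL_zero, map_one, one_mul]

theorem TorusExpansion.top_mul_lower [Infinite k] (h : TorusExpansion ρ N D H)
    (hρ : IsRegularMap (fun A => ρ A)) (s : k) : H D * ρ (lowerSL s) = H D := by
  obtain ⟨M, c, hc⟩ := (hρ.map (LinearMap.mulLeft k (H D))).exists_lower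
  simp only [LinearMap.mulLeft_apply] at hc
  have hz : ∀ j, 0 < j → j < M → c j = 0 := by
    intro j
    refine eq_of_degree_bound (k := k) (D := D) (d := fun i => H D * ρ (lowerSL 1) * H i) ?_
    intro t ht
    calc _ = (H D * ρ (lowerSL 1)) * (t ^ N • ρ (torusSL t ht)) := by
          rw [h t ht, Finset.mul_sum]
          simp only [mul_smul_comm]
      _ = (H D * (t ^ N • ρ (torusSL t ht))) * ρ (lowerSL (t ^ 2)) := by
          rw [mul_assoc, mul_smul_comm, ← map_mul, lowerSL_mul_torusSL, mul_one, map_mul,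
            mul_assoc, smul_mul_assoc]
      _ = t ^ D • (H D * ρ (lowerSL (t ^ 2))) := by
          rw [h.top_mul_torus t ht, smul_mul_assoc]
      _ = _ := by
          rw [hc, Finset.smul_sum]
          refine Finset.sum_congr rfl fun i _ => ?_
          rw [smul_smul]
          ring_nf
  rw [hc, sum_range_eq_of_forall_pos_eq_zero hz, ← hc, lowerSL_zero, map_one, mul_one]

/-- A regular homomorphism without positive weights is trivial. -/
theorem TorusExpansion.eq_one_of_le [Infinite k] (h : TorusExpansion ρ N N H)
    (hρ : IsRegularMap (fun A => ρ A)) (A : SpecialLinearGroup (Fin 2) k) : ρ A = 1 := by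
  have hcoeff : ∀ i, i < N → H i = 0 := by
    intro i hi
    have hw : ∀ t : k, t ≠ 0 → ∑ i ∈ Finset.range (N + 1), t ^ i • (ρ (weylSL k) * H i) =
        ∑ i ∈ Finset.range (N + 1), t ^ (2 * N - i) • (H i * ρ (weylSL k)) := by
      intro t ht
      calc _ = ρ (weylSL k) * (t ^ N • ρ (torusSL t ht)) := by
            rw [h t ht, Finset.mul_sum]
            simp only [mul_smul_comm]
        _ = t ^ (2 * N) • (((t⁻¹) ^ N • ρ (torusSL t⁻¹ (inv_ne_zero ht))) * ρ (weylSL k)) := by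
            rw [mul_smul_comm, ← map_mul, weylSL_mul_torusSL, smul_mul_assoc, ← map_mul, smul_smul]
            congr 1
            rw [two_mul, pow_add, inv_pow, mul_assoc, mul_inv_cancel₀ (pow_ne_zero _ ht), mul_one]
        _ = _ := by
            rw [h t⁻¹ (inv_ne_zero ht), Finset.sum_mul, Finset.smul_sum]
            refine Finset.sum_congr rfl fun i hi => ?_
            rw [smul_mul_assoc, smul_smul]
            congr 1
            have hi' : i ≤ 2 * N := by
              simp only [Finset.mem_range] at hi
              omega
            rw [inv_pow, ← pow_sub₀ _ ht hi']
    have := sum_filter_eq_of_pow_smul_eq _ _ _ _ _ _ hw i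
    rw [Finset.sum_eq_single i, Finset.filter_false_of_mem, Finset.sum_empty] at this
    · have h2 : ρ (weylSL k)⁻¹ * (ρ (weylSL k) * H i) = 0 := by rw [this, mul_zero]
      rwa [← mul_assoc, ← map_mul, inv_mul_cancel, map_one, one_mul] at h2
    · intro j hj
      simp only [Finset.mem_range] at hj
      omega
    · intro j hj hne
      simp only [Finset.mem_filter] at hj
      omega
    · intro hn
      exact (hn (Finset.mem_filter.2 ⟨Finset.mem_range.2 (by omega), rfl⟩)).elim
  have hone : H N = 1 := by
    have := h 1 one_ne_zero
    rw [Finset.sum_range_succ, Finset.sum_eq_zero] at this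
    · simpa [torusSL_one] using this.symm
    · intro i hi
      rw [hcoeff i (Finset.mem_range.1 hi), smul_zero]
  refine eq_one_of_unitriangular ρ (fun s => ?_) (fun s => ?_) A
  · simpa [hone] using h.upper_mul_top hρ s
  · simpa [hone] using h.top_mul_lower hρ s

end TopWeight

section Curves
variable {k V : Type*} [Field k] [AddCommGroup V] [Module k V]

/-- The binary form of degree `m` with vector coefficients `c`. -/
def binaryForm (m : ℕ) (c : ℕ → V) (x y : k) : V :=
  ∑ j ∈ Finset.range (m + 1), (x ^ (m - j) * y ^ j) • c j

/-- The binary form with coefficients `c` is an `SL(2,k)`-equivariant map to `V`. -/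
def IsEquivariantForm (ρ : SpecialLinearGroup (Fin 2) k →* Module.End k V) (m : ℕ)
    (c : ℕ → V) : Prop :=
  ∀ (A : SpecialLinearGroup (Fin 2) k) (x y : k), (x ≠ 0 ∨ y ≠ 0) →
    ρ A (binaryForm m c x y) =
      binaryForm m c (A.1 0 0 * x + A.1 0 1 * y) (A.1 1 0 * x + A.1 1 1 * y)

variable {ρ : SpecialLinearGroup (Fin 2) k →* Module.End k V}

theorem binaryForm_one_left (m : ℕ) (c : ℕ → V) (y : k) :
    binaryForm m c 1 y = ∑ j ∈ Finset.range (m + 1), y ^ j • c j := by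
  simp [binaryForm]

theorem binaryForm_zero_left (m : ℕ) (c : ℕ → V) (y : k) :
    binaryForm m c 0 y = y ^ m • c m := by
  rw [binaryForm, Finset.sum_eq_single m]
  · simp
  · intro j hj hne
    have : m - j ≠ 0 := by
      simp only [Finset.mem_range] at hj
      omega
    simp [this]
  · simp

theorem isEquivariantForm_of_orbit {m : ℕ} {c : ℕ → V} {v : V}
    (h : ∀ A : SpecialLinearGroup (Fin 2) k, ρ A v = binaryForm m c (A.1 0 0) (A.1 1 0)) :
    IsEquivariantForm ρ m c := by
  intro A x y hxy
  obtain ⟨B, rfl, rfl⟩ := exists_SL_first_column x y hxy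
  rw [← h B, ← Module.End.mul_apply, ← map_mul, h, SLTwo.mul_entry, SLTwo.mul_entry]

theorem sum_zero_pow_smul_eq [Infinite k] {ι κ : Type*} {S : Finset ι} {T : Finset κ}
    {e : ι → ℕ} {f : κ → ℕ} {x : ι → V} {y : κ → V}
    (h : ∀ t : k, t ≠ 0 → ∑ i ∈ S, t ^ e i • x i = ∑ j ∈ T, t ^ f j • y j) :
    ∑ i ∈ S, (0 : k) ^ e i • x i = ∑ j ∈ T, (0 : k) ^ f j • y j := by
  have := sum_filter_eq_of_pow_smul_eq S T e f x y h 0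
  simpa [Finset.sum_filter, zero_pow_eq, ite_smul] using this

/-- The matrices `[[a, -1], [1, 0]]`. -/
def shiftedWeylSL (a : k) : SpecialLinearGroup (Fin 2) k := ⟨!![a, -1; 1, 0], by simp⟩

theorem shiftedWeylSL_val (a : k) : (shiftedWeylSL a).1 = !![a, -1; 1, 0] := rfl

theorem shiftedWeylSL_zero : shiftedWeylSL (0 : k) = weylSL k := rfl

theorem IsRegularMap.exists_shiftedWeyl {g : SpecialLinearGroup (Fin 2) k → V}
    (hg : IsRegularMap g) :
    ∃ (M : ℕ) (c : ℕ → V), ∀ s, g (shiftedWeylSL s) = ∑ j ∈ Finset.range M, s ^ j • c j := by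
  obtain ⟨M, c, h⟩ := hg.exists_polynomial
    (fun z => !![Polynomial.X, -1; 1, 0] z.1 z.2)
  refine ⟨M, c, fun s => h s _ ?_⟩
  rintro ⟨i, j⟩
  fin_cases i <;> fin_cases j <;> simp [shiftedWeylSL_val]

/-- The orbit map of a highest weight vector is a binary form of degree the weight. -/
theorem exists_orbit_eq_binaryForm [Infinite k] (hρ : IsRegularMap (fun A => ρ A)) {v : V}
    (hv : v ≠ 0) {N D : ℕ} (ht : ∀ (t : k) (ht : t ≠ 0), t ^ N • ρ (torusSL t ht) v = t ^ D • v)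
    (hu : ∀ s, ρ (upperSL s) v = v) :
    N ≤ D ∧ ∃ c : ℕ → V, ∀ A : SpecialLinearGroup (Fin 2) k,
      ρ A v = binaryForm (D - N) c (A.1 0 0) (A.1 1 0) := by
  have hreg : IsRegularMap (fun A => ρ A v) := hρ.map (LinearMap.applyₗ v)
  obtain ⟨M, F, hF⟩ := hreg.exists_lower
  obtain ⟨M', G, hG⟩ := hreg.exists_shiftedWeyl
  have hcell : ∀ (A : SpecialLinearGroup (Fin 2) k) (ha : A.1 0 0 ≠ 0),
      (A.1 0 0) ^ N • ρ A v = (A.1 0 0) ^ D • ρ (lowerSL (A.1 1 0 / A.1 0 0)) v := by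
    intro A ha
    have hA : ρ A v =
        ρ (lowerSL (A.1 1 0 / A.1 0 0)) (ρ (torusSL (A.1 0 0) ha)
          (ρ (upperSL (A.1 0 1 / A.1 0 0)) v)) := by
      rw [← Module.End.mul_apply, ← Module.End.mul_apply, ← map_mul, ← map_mul]
      exact congrArg (fun B => ρ B v) (eq_lowerSL_mul_torusSL_mul_upperSL A ha)
    rw [hA, hu, ← map_smul, ht, map_smul]
  have hpoly : ∀ a : k, a ≠ 0 → ∑ i ∈ Finset.range M', a ^ (N + M + i) • G i =
      ∑ j ∈ Finset.range M, a ^ (D + M - j) • F j := by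
    intro a ha
    have h1 := hcell (shiftedWeylSL a) (by simpa [shiftedWeylSL_val] using ha)
    simp only [shiftedWeylSL_val, Matrix.of_apply, Matrix.cons_val', Matrix.cons_val_zero,
      Matrix.cons_val_one, Matrix.cons_val_fin_one] at h1
    rw [hG, hF, Finset.smul_sum, Finset.smul_sum] at h1
    have h2 := congrArg (fun w => a ^ M • w) h1
    simp only [Finset.smul_sum, smul_smul] at h2
    refine Eq.trans (Finset.sum_congr rfl fun i _ => ?_)
      (h2.trans (Finset.sum_congr rfl fun j hj => ?_))
    · congr 1
      ring
    · congr 1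
      have hj' : j ≤ D + M := by
        simp only [Finset.mem_range] at hj
        omega
      rw [pow_sub₀ _ ha hj', one_div, inv_pow, pow_add]
      ring
  have hzero : ∀ j, j < M → D < N + j → F j = 0 := by
    intro j hj hlt
    have := sum_filter_eq_of_pow_smul_eq _ _ _ _ _ _ hpoly (D + M - j)
    rw [Finset.filter_false_of_mem, Finset.sum_empty, Finset.sum_eq_single j] at this
    · exact this.symm
    · intro i hi hne
      simp only [Finset.mem_filter, Finset.mem_range] at hi
      omega
    · intro hn
      exact (hn (Finset.mem_filter.2 ⟨Finset.mem_range.2 hj, rfl⟩)).elim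
    · intro i _
      omega
  have hND : N ≤ D := by
    by_contra hlt
    apply hv
    have h0 := hF 0
    rw [lowerSL_zero, map_one, Module.End.one_apply] at h0
    rw [h0]
    refine Finset.sum_eq_zero fun j hj => ?_
    rw [hzero j (Finset.mem_range.1 hj) (by omega), smul_zero]
  refine ⟨hND, fun j => if j < M then F j else 0, ?_⟩
  set m := D - N with hm
  set c : ℕ → V := fun j => if j < M then F j else 0 with hc
  have hlow : ∀ s : k, ρ (lowerSL s) v = binaryForm m c 1 s := by
    intro s
    rw [hF, binaryForm_one_left]
    apply Finset.sum_congr_of_eq_on_inter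
    · intro j hj hj'
      simp only [Finset.mem_range] at hj hj'
      rw [hzero j hj (by omega), smul_zero]
    · intro j hj hj'
      simp only [Finset.mem_range] at hj hj'
      simp [hc, hj']
    · intro j hj hj'
      simp only [Finset.mem_range] at hj hj'
      simp [hc, hj]
  have hcell' : ∀ (A : SpecialLinearGroup (Fin 2) k), A.1 0 0 ≠ 0 →
      ρ A v = binaryForm m c (A.1 0 0) (A.1 1 0) := by
    intro A ha
    have h1 := hcell A ha
    rw [hlow, ← Nat.sub_add_cancel hND, ← hm, add_comm, pow_add, mul_smul] at h1
    rw [smul_right_injective V (pow_ne_zero N ha) h1, binaryForm, binaryForm, Finset.smul_sum]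
    refine Finset.sum_congr rfl fun j hj => ?_
    rw [smul_smul]
    congr 1
    have hj' : j ≤ m := by
      simp only [Finset.mem_range] at hj
      omega
    rw [one_pow, one_mul, div_pow, pow_sub₀ _ ha hj']
    ring
  have hweyl : ρ (weylSL k) v = c m := by
    have h1 : ∀ a : k, a ≠ 0 → ∑ i ∈ Finset.range M', a ^ i • G i =
        ∑ j ∈ Finset.range (m + 1), a ^ (m - j) • c j := by
      intro a ha
      rw [← hG, hcell' _ (by simpa [shiftedWeylSL_val] using ha)]
      simp [binaryForm, shiftedWeylSL_val]
    have h2 := sum_zero_pow_smul_eq h1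
    rw [← hG, shiftedWeylSL_zero] at h2
    rw [h2]
    have := binaryForm_zero_left m c (1 : k)
    simpa [binaryForm] using this
  intro A
  by_cases ha : A.1 0 0 = 0
  · have hc0 : A.1 1 0 ≠ 0 := by
      intro h0
      have := SLTwo.det_eq A
      simp [ha, h0] at this
    have hA : ρ A v = ρ (weylSL k) (ρ (torusSL (A.1 1 0) hc0)
          (ρ (upperSL (A.1 1 1 / A.1 1 0)) v)) := by
      rw [← Module.End.mul_apply, ← Module.End.mul_apply, ← map_mul, ← map_mul]
      exact congrArg (fun B => ρ B v) (eq_weylSL_mul_torusSL_mul_upperSL A ha hc0)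
    have h1 := ht (A.1 1 0) hc0
    rw [← Nat.sub_add_cancel hND, ← hm, add_comm, pow_add, mul_smul] at h1
    rw [hA, hu, smul_right_injective V (pow_ne_zero N hc0) h1, map_smul, hweyl, ha,
      binaryForm_zero_left]
  · exact hcell' A ha

/-- The contragredient representation twisted by transposition: it acts on the dual space and has
the same weights. -/
def transposeDual (ρ : SpecialLinearGroup (Fin 2) k →* Module.End k V) :
    SpecialLinearGroup (Fin 2) k →* Module.End k (Module.Dual k V) where
  toFun A := Module.Dual.transpose (R := k) (ρ A.transpose)
  map_one' := by
    have : (1 : SpecialLinearGroup (Fin 2) k).transpose = 1 := by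
      apply Subtype.ext
      simp [SpecialLinearGroup.transpose]
    rw [this, map_one]
    rfl
  map_mul' A B := by
    have : (A * B).transpose = B.transpose * A.transpose := by
      apply Subtype.ext
      exact Matrix.transpose_mul A.1 B.1
    rw [this, map_mul]
    rfl

theorem transposeDual_apply (A : SpecialLinearGroup (Fin 2) k) (ξ : Module.Dual k V) (v : V) :
    transposeDual ρ A ξ v = ξ (ρ A.transpose v) := rfl

theorem IsRegularMap.transposeDual (hρ : IsRegularMap (fun A => ρ A)) :
    IsRegularMap (fun A => _root_.transposeDual ρ A) := by
  exact hρ.comp_transpose.map (W := Module.End k (Module.Dual k V))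
    (Module.Dual.transpose (R := k) (M := V) (M' := V))

/-- Every nonzero regular representation carries a highest weight form and a dual one, paired by
binomial coefficients. -/
theorem exists_highestWeight [Infinite k] [Nontrivial V] (hρ : IsRegularMap (fun A => ρ A)) :
    ∃ (m : ℕ) (v : ℕ → V) (ξ : ℕ → Module.Dual k V),
      IsEquivariantForm ρ m v ∧ IsEquivariantForm (transposeDual ρ) m ξ ∧
      (∀ i ≤ m, ∀ j ≤ m, ξ i (v j) = if i = j then (m.choose j : k) else 0) ∧
      (m = 0 → ∀ A, ρ A = 1) := by
  obtain ⟨N, D, H, hH, hD⟩ := exists_torusExpansion hρ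
  obtain ⟨z, hz⟩ : ∃ z, H D z ≠ 0 := by
    by_contra! hcon
    exact hD (LinearMap.ext hcon)
  obtain ⟨φ, hφ⟩ : ∃ φ : Module.Dual k V, φ (H D (H D z)) ≠ 0 := by
    by_contra! hcon
    have h0 := (Module.forall_dual_apply_eq_zero_iff k _).1 hcon
    have hidem : ∀ i, i < D + 1 → H D (H i z) = if i = D then H D z else 0 := by
      intro i hi
      refine eq_of_sum_range_pow_smul_eq (k := k) (n := D + 1) (x := fun i => H D (H i z))
        (y := fun i => if i = D then H D z else 0) ?_ hi
      intro t ht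
      have h1 := congrArg (fun f => f z) (hH.top_mul_torus t ht)
      simp only [hH t ht] at h1
      simpa using h1
    have := hidem D (Nat.lt_succ_self D)
    simp only [if_true] at this
    exact hz (this ▸ h0)
  set w : V := H D z with hw
  set ψ : Module.Dual k V := (φ (H D w))⁻¹ • (φ ∘ₗ H D) with hψ
  have hψw : ψ w = 1 := by simp [hψ, hφ]
  have hψ0 : ψ ≠ 0 := fun h => by simp [h] at hψw
  have hwt : ∀ (t : k) (ht : t ≠ 0), t ^ N • ρ (torusSL t ht) w = t ^ D • w := by
    intro t ht
    have := congrArg (fun f => f z) (hH.torus_mul_top t ht)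
    simpa using this
  have hwu : ∀ s, ρ (upperSL s) w = w := by
    intro s
    exact congrArg (fun f => f z) (hH.upper_mul_top hρ s)
  have hψt : ∀ (t : k) (ht : t ≠ 0), t ^ N • transposeDual ρ (torusSL t ht) ψ = t ^ D • ψ := by
    intro t ht
    ext x
    have := congrArg (fun f => φ (f x)) (hH.top_mul_torus t ht)
    simp only [Module.End.mul_apply, LinearMap.smul_apply, map_smul, smul_eq_mul] at this
    simp only [LinearMap.smul_apply, transposeDual_apply, transpose_torusSL, hψ,
      LinearMap.comp_apply, smul_eq_mul]
    linear_combination (φ (H D w))⁻¹ * this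
  have hψl : ∀ s x, ψ (ρ (lowerSL s) x) = ψ x := by
    intro s x
    have := congrArg (fun f => φ (f x)) (hH.top_mul_lower hρ s)
    simp only [Module.End.mul_apply] at this
    simp [hψ, this]
  have hψu : ∀ s, transposeDual ρ (upperSL s) ψ = ψ := by
    intro s
    ext x
    rw [transposeDual_apply, transpose_upperSL, hψl]
  obtain ⟨hND, v, hv⟩ := exists_orbit_eq_binaryForm hρ hz hwt hwu
  obtain ⟨-, ξ, hξ⟩ := exists_orbit_eq_binaryForm hρ.transposeDual hψ0 hψt hψu
  refine ⟨D - N, v, ξ, isEquivariantForm_of_orbit hv, isEquivariantForm_of_orbit hξ, ?_, ?_⟩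
  · set m := D - N with hm
    have hψv : ∀ j < m + 1, ψ (v j) = if j = 0 then 1 else 0 := by
      intro j hj
      refine eq_of_sum_range_pow_smul_eq (k := k) (n := m + 1) (x := fun j => ψ (v j))
        (y := fun j => if j = 0 then 1 else 0) ?_ hj
      intro s _
      have h1 := hψl s w
      rw [hv, hψw] at h1
      simp only [lowerSL_val, binaryForm] at h1
      simpa using h1
    have hpair : ∀ b y : k, ∑ i ∈ Finset.range (m + 1), b ^ i •
        ∑ j ∈ Finset.range (m + 1), y ^ j • ξ i (v j) = (1 + b * y) ^ m := by
      intro b y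
      have h1 : transposeDual ρ (lowerSL b) ψ (ρ (lowerSL y) w) =
          ψ (ρ ((lowerSL b).transpose * lowerSL y) w) := by
        rw [transposeDual_apply, map_mul, Module.End.mul_apply]
      rw [hξ, hv, hv, SLTwo.mul_entry, SLTwo.mul_entry] at h1
      simp only [lowerSL_val, SpecialLinearGroup.coe_transpose] at h1
      simp only [Matrix.of_apply, Matrix.cons_val', Matrix.cons_val_zero,
        Matrix.cons_val_one, Matrix.cons_val_fin_one, Matrix.transpose_apply] at h1
      rw [binaryForm_one_left, binaryForm_one_left] at h1
      simp only [LinearMap.sum_apply, LinearMap.smul_apply, map_sum, map_smul, binaryForm,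
        Finset.smul_sum] at h1
      simp only [Finset.smul_sum]
      rw [Finset.sum_comm] at h1
      simp only [smul_comm (y ^ _) (b ^ _)] at h1
      rw [h1, Finset.sum_eq_single 0]
      · simp [hψv 0 (Nat.succ_pos m)]
      · intro j hj hne
        simp [hψv j (Finset.mem_range.1 hj), hne]
      · simp
    intro i hi j hj
    refine eq_of_sum_range_pow_smul_eq (k := k) (n := m + 1) (x := fun j => ξ i (v j))
        (y := fun j => if i = j then (m.choose j : k) else 0) ?_ (Nat.lt_succ_of_le hj)
    intro y _
    refine eq_of_sum_range_pow_smul_eq (k := k) (n := m + 1)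
      (x := fun i => ∑ j ∈ Finset.range (m + 1), y ^ j • ξ i (v j))
        (y := fun i => ∑ j ∈ Finset.range (m + 1), y ^ j • if i = j then (m.choose j : k) else 0)
        ?_ (Nat.lt_succ_of_le hi)
    intro b _
    rw [hpair, add_comm, add_pow]
    refine Finset.sum_congr rfl fun i hi => ?_
    simp only [Finset.mem_range] at hi
    simp only [smul_eq_mul, mul_ite, mul_zero, Finset.sum_ite_eq, Finset.mem_range, hi, if_true]
    ring
  · intro h0
    have : D = N := by omega
    subst this
    exact hH.eq_one_of_le hρ

end Curves

section FormCoefficients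
variable {k V : Type*} [Field k] [AddCommGroup V] [Module k V]
variable {ρ : SpecialLinearGroup (Fin 2) k →* Module.End k V} {m : ℕ} {c : ℕ → V}

theorem IsEquivariantForm.apply_sum (h : IsEquivariantForm ρ m c)
    (A : SpecialLinearGroup (Fin 2) k) (y : k) :
    ∑ j ∈ Finset.range (m + 1), y ^ j • ρ A (c j) =
      binaryForm m c (A.1 0 0 + A.1 0 1 * y) (A.1 1 0 + A.1 1 1 * y) := by
  have := h A 1 y (Or.inl one_ne_zero)
  rw [binaryForm_one_left] at this
  simpa using this

variable [Infinite k]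

theorem IsEquivariantForm.torus_apply (h : IsEquivariantForm ρ m c) {t : k} (ht : t ≠ 0) {j : ℕ}
    (hj : j ≤ m) : t ^ m • ρ (torusSL t ht) (c j) = t ^ (2 * (m - j)) • c j := by
  refine eq_of_sum_range_pow_smul_eq (k := k) (n := m + 1)
    (x := fun j => t ^ m • ρ (torusSL t ht) (c j)) (y := fun j => t ^ (2 * (m - j)) • c j) ?_
    (Nat.lt_succ_of_le hj)
  intro y _
  have h1 := congrArg (fun w => t ^ m • w) (h.apply_sum (torusSL t ht) y)
  simp only [Finset.smul_sum, binaryForm, torusSL_val] at h1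
  refine Eq.trans (Finset.sum_congr rfl fun j _ => smul_comm _ _ _)
    (h1.trans (Finset.sum_congr rfl fun j hj => ?_))
  simp only [Finset.mem_range] at hj
  have hm : t ^ m = t ^ (m - j) * t ^ j := by rw [← pow_add]; congr 1; omega
  rw [smul_smul, smul_smul]
  congr 1
  simp [hm, mul_pow, two_mul, pow_add]
  field_simp

theorem IsEquivariantForm.linearIndepOn (h : IsEquivariantForm ρ m c) {S : Finset ℕ}
    (hS : ∀ j ∈ S, j ≤ m ∧ c j ≠ 0) : LinearIndepOn k c (S : Set ℕ) := by
  rw [linearIndepOn_finset_iff]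
  intro g hg j hj
  have hinj : Set.InjOn (fun j => 2 * (m - j)) (S : Set ℕ) := by
    intro a ha b hb hab
    have h1 := (hS a ha).1
    have h2 := (hS b hb).1
    simp only at hab
    omega
  have := eq_zero_of_sum_pow_smul_eq_zero (k := k) hinj (x := fun j => g j • c j) (fun t ht => by
    have h1 := congrArg (fun w => t ^ m • ρ (torusSL t ht) w) hg
    simp only [map_sum, map_zero, smul_zero, Finset.smul_sum, map_smul] at h1
    refine Eq.trans (Finset.sum_congr rfl fun j hj => ?_) h1
    rw [smul_comm (t ^ m), h.torus_apply ht (hS j hj).1, smul_comm]) hj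
  exact (smul_eq_zero.1 this).resolve_right (hS j hj).2

theorem IsEquivariantForm.card_le_finrank [FiniteDimensional k V] (h : IsEquivariantForm ρ m c)
    {S : Finset ℕ} (hS : ∀ j ∈ S, j ≤ m ∧ c j ≠ 0) : S.card ≤ Module.finrank k V := by
  have := (h.linearIndepOn hS).linearIndependent.fintype_card_le_finrank
  simpa using this

theorem IsEquivariantForm.weyl_apply (h : IsEquivariantForm ρ m c) {j : ℕ} (hj : j ≤ m) :
    ρ (weylSL k) (c j) = (-1 : k) ^ j • c (m - j) := by
  refine eq_of_sum_range_pow_smul_eq (k := k) (n := m + 1)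
    (x := fun j => ρ (weylSL k) (c j)) (y := fun j => (-1 : k) ^ j • c (m - j)) ?_
    (Nat.lt_succ_of_le hj)
  intro y _
  rw [h.apply_sum, binaryForm, ← Finset.sum_range_reflect]
  refine Finset.sum_congr rfl fun j hj => ?_
  simp only [Finset.mem_range] at hj
  have hj' : m - (m + 1 - 1 - j) = j := by omega
  rw [smul_smul, hj']
  simp [weylSL_val, neg_pow y, mul_comm]

theorem IsEquivariantForm.ne_zero_symm (h : IsEquivariantForm ρ m c) {j : ℕ} (hj : j ≤ m)
    (hc : c j ≠ 0) : c (m - j) ≠ 0 := by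
  intro h0
  have := h.weyl_apply (Nat.sub_le m j)
  rw [h0, map_zero, Nat.sub_sub_self hj, eq_comm, smul_eq_zero] at this
  exact this.elim (by simp) hc

/-- If a coefficient vanishes, so do the binomial coefficients through which earlier nonzero
coefficients contribute to it under the upper unitriangular group. -/
theorem IsEquivariantForm.choose_eq_zero (h : IsEquivariantForm ρ m c) {j n : ℕ} (hjn : j ≤ n)
    (hn : n ≤ m) (hc : c j ≠ 0) (h0 : c n = 0) : ((m - j).choose (n - j) : k) = 0 := by
  have hexp : ∀ s y : k, ∑ i ∈ Finset.range (m + 1), y ^ i • ρ (upperSL s) (c i) =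
      ∑ p ∈ (Finset.range (m + 1)).sigma (fun j => Finset.range (m - j + 1)),
        y ^ (p.1 + p.2) • s ^ p.2 • ((m - p.1).choose p.2 : k) • c p.1 := by
    intro s y
    rw [h.apply_sum, binaryForm, Finset.sum_sigma]
    refine Finset.sum_congr rfl fun i _ => ?_
    simp only [upperSL_val, Matrix.of_apply, Matrix.cons_val', Matrix.cons_val_zero,
      Matrix.cons_val_one, Matrix.cons_val_fin_one]
    rw [add_comm 1, add_pow, zero_add, one_mul, Finset.sum_mul, Finset.sum_smul]
    refine Finset.sum_congr rfl fun l _ => ?_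
    rw [smul_smul, smul_smul]
    congr 1
    ring
  have hcoeff : ∀ s : k, s ≠ 0 → ∑ p ∈ (Finset.range (m + 1)).sigma
      (fun j => Finset.range (m - j + 1)) with p.1 + p.2 = n,
        s ^ p.2 • ((m - p.1).choose p.2 : k) • c p.1 = 0 := by
    intro s _
    have := sum_filter_eq_of_pow_smul_eq _ _ _ _ _ _ (fun y _ => hexp s y) n
    rw [← this]
    refine Finset.sum_eq_zero fun i hi => ?_
    rw [(Finset.mem_filter.1 hi).2, h0, map_zero]
  have hinj : Set.InjOn (fun p : (_ : ℕ) × ℕ => p.2)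
      ({p ∈ (Finset.range (m + 1)).sigma (fun j => Finset.range (m - j + 1)) |
        p.1 + p.2 = n} : Finset ((_ : ℕ) × ℕ)) := by
    rintro ⟨a, b⟩ ha ⟨a', b'⟩ ha' hb
    simp only [Finset.coe_filter, Set.mem_ofPred_eq] at ha ha' hb
    subst hb
    have : a = a' := by omega
    rw [this]
  have := eq_zero_of_sum_pow_smul_eq_zero hinj hcoeff (j := ⟨j, n - j⟩) (by
    simp only [Finset.mem_filter, Finset.mem_sigma, Finset.mem_range]
    omega)
  exact (smul_eq_zero.1 this).resolve_right hc

/-- The action on the nonzero coefficients of an equivariant form is read off from the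
transformation of the corresponding monomials. -/
theorem IsEquivariantForm.apply_eq_sum (h : IsEquivariantForm ρ m c) {n : ℕ} {idx : Fin n → ℕ}
    (hidx : Function.Injective idx) (hle : ∀ i, idx i ≤ m) {b : Fin n → V} {κ : Fin n → k}
    (hκ : ∀ i, κ i ≠ 0) (hc : ∀ i, c (idx i) = κ i • b i)
    (h0 : ∀ j ≤ m, (∀ i, idx i ≠ j) → c j = 0) (A : SpecialLinearGroup (Fin 2) k)
    {T : Matrix (Fin n) (Fin n) k}
    (hT : ∀ i y, κ i * ((A.1 0 0 + A.1 0 1 * y) ^ (m - idx i) *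
      (A.1 1 0 + A.1 1 1 * y) ^ idx i) = ∑ j, T i j * (κ j * y ^ idx j)) (j : Fin n) :
    ρ A (b j) = ∑ i, T i j • b i := by
  have hsum : ∀ f : ℕ → k, ∀ L : V →ₗ[k] V, ∑ j ∈ Finset.range (m + 1), f j • L (c j) =
      ∑ i, (f (idx i) * κ i) • L (b i) := by
    intro f L
    have himg : ∑ j ∈ Finset.univ.image idx, f j • L (c j) =
        ∑ j ∈ Finset.range (m + 1), f j • L (c j) := by
      refine Finset.sum_subset ?_ ?_
      · intro j hj
        obtain ⟨i, -, rfl⟩ := Finset.mem_image.1 hj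
        exact Finset.mem_range.2 (Nat.lt_succ_of_le (hle i))
      · intro j hj hj'
        rw [h0 j (Nat.lt_succ_iff.1 (Finset.mem_range.1 hj))
          (fun i hi => hj' (Finset.mem_image.2 ⟨i, Finset.mem_univ _, hi⟩)), map_zero, smul_zero]
    rw [← himg, Finset.sum_image (hidx.injOn)]
    refine Finset.sum_congr rfl fun i _ => ?_
    rw [hc, map_smul, smul_smul]
  have key : ∀ y : k, y ≠ 0 →
      ∑ j, y ^ idx j • (κ j • (ρ A (b j) - ∑ i, T i j • b i)) = 0 := by
    intro y _
    have h1 := h.apply_sum A y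
    have h2 := hsum (fun j => (A.1 0 0 + A.1 0 1 * y) ^ (m - j) * (A.1 1 0 + A.1 1 1 * y) ^ j)
      LinearMap.id
    simp only [LinearMap.id_apply] at h2
    rw [hsum, binaryForm, h2] at h1
    simp only [smul_sub, Finset.sum_sub_distrib, sub_eq_zero, smul_smul]
    rw [h1]
    calc _ = ∑ i, ∑ j, (T i j * (κ j * y ^ idx j)) • b i := by
          refine Finset.sum_congr rfl fun i _ => ?_
          rw [mul_comm, hT, Finset.sum_smul]
      _ = _ := by
          rw [Finset.sum_comm]
          refine Finset.sum_congr rfl fun j _ => ?_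
          rw [Finset.smul_sum]
          refine Finset.sum_congr rfl fun i _ => ?_
          rw [smul_smul]
          congr 1
          ring
  have := eq_zero_of_sum_pow_smul_eq_zero (k := k) (S := Finset.univ) hidx.injOn key
    (Finset.mem_univ j)
  exact sub_eq_zero.1 ((smul_eq_zero.1 this).resolve_left (hκ j))

end FormCoefficients

section Lucas

theorem three_dvd_choose_iff {a b r s : ℕ} (hr : r < 3) (hs : s < 3) :
    3 ∣ (3 * a + r).choose (3 * b + s) ↔ 3 ∣ r.choose s ∨ 3 ∣ a.choose b := by
  have : Fact (Nat.Prime 3) := ⟨Nat.prime_three⟩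
  have h := Choose.choose_modEq_choose_mod_mul_choose_div_nat (n := 3 * a + r) (k := 3 * b + s)
    (p := 3)
  have h1 : (3 * a + r) % 3 = r := by omega
  have h2 : (3 * b + s) % 3 = s := by omega
  have h3 : (3 * a + r) / 3 = a := by omega
  have h4 : (3 * b + s) / 3 = b := by omega
  rw [h1, h2, h3, h4] at h
  rw [← Nat.prime_three.dvd_mul, Nat.dvd_iff_mod_eq_zero, Nat.dvd_iff_mod_eq_zero, h]

theorem three_dvd_choose_three_mul_iff {a b : ℕ} : 3 ∣ (3 * a).choose (3 * b) ↔ 3 ∣ a.choose b := by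
  simpa using three_dvd_choose_iff (a := a) (b := b) (r := 0) (s := 0) (by norm_num) (by norm_num)

theorem three_dvd_choose_three_pow_mul_iff {a b : ℕ} (e : ℕ) :
    3 ∣ (3 ^ e * a).choose (3 ^ e * b) ↔ 3 ∣ a.choose b := by
  induction e with
  | zero => simp
  | succ e ih => rw [pow_succ', mul_assoc, mul_assoc, three_dvd_choose_three_mul_iff, ih]

/-- There are at most `n` binomial coefficients `m.choose j` prime to three. -/
def ChooseCountLE (m n : ℕ) : Prop :=
  ∀ S : Finset ℕ, (∀ j ∈ S, j ≤ m ∧ ¬ 3 ∣ m.choose j) → S.card ≤ n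

theorem ChooseCountLE.of_three_mul {w n : ℕ} (h : ChooseCountLE (3 * w) n) :
    ChooseCountLE w n := by
  intro S hS
  have := h (S.image (3 * ·)) (by
    intro j hj
    obtain ⟨i, hi, rfl⟩ := Finset.mem_image.1 hj
    rw [three_dvd_choose_three_mul_iff]
    exact ⟨Nat.mul_le_mul_left 3 (hS i hi).1, (hS i hi).2⟩)
  rwa [Finset.card_image_of_injective _ (fun a b hab => by simpa using hab)] at this

theorem ChooseCountLE.of_three_mul_add_one {w n : ℕ} (h : ChooseCountLE (3 * w + 1) (2 * n)) :
    ChooseCountLE w n := by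
  intro S hS
  have hdisj : Disjoint (S.image (3 * ·)) (S.image (3 * · + 1)) := by
    rw [Finset.disjoint_left]
    intro a ha hb
    obtain ⟨i, -, rfl⟩ := Finset.mem_image.1 ha
    obtain ⟨j, -, hj⟩ := Finset.mem_image.1 hb
    omega
  have h1 := h (S.image (3 * ·) ∪ S.image (3 * · + 1)) (by
    intro j hj
    rcases Finset.mem_union.1 hj with hj | hj
    · obtain ⟨i, hi, rfl⟩ := Finset.mem_image.1 hj
      have h1 := three_dvd_choose_iff (a := w) (b := i) (r := 1) (s := 0) (by norm_num)
        (by norm_num)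
      obtain ⟨h2, h3⟩ := hS i hi
      simp only [add_zero] at h1
      rw [h1]
      exact ⟨by omega, by simpa using h3⟩
    · obtain ⟨i, hi, rfl⟩ := Finset.mem_image.1 hj
      have h1 := three_dvd_choose_iff (a := w) (b := i) (r := 1) (s := 1) (by norm_num)
        (by norm_num)
      obtain ⟨h2, h3⟩ := hS i hi
      rw [h1]
      exact ⟨by omega, by simpa using h3⟩)
  rw [Finset.card_union_of_disjoint hdisj,
    Finset.card_image_of_injective _ (fun a b hab => by simpa using hab),
    Finset.card_image_of_injective _ (fun a b hab => by simpa using hab)] at h1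
  omega

theorem not_chooseCountLE_three_mul_add_one {w : ℕ} (hw : 0 < w) :
    ¬ ChooseCountLE (3 * w + 1) 3 := by
  intro h
  have hval : ∀ b s, b = 0 ∨ b = w → s = 0 ∨ s = 1 → ¬ 3 ∣ (3 * w + 1).choose (3 * b + s) := by
    intro b s hb hs
    rw [three_dvd_choose_iff (by norm_num) (by omega)]
    rcases hb with rfl | rfl <;> rcases hs with rfl | rfl <;> simp
  have := h {3 * 0 + 0, 3 * 0 + 1, 3 * w + 0, 3 * w + 1} (by
    intro j hj
    simp only [Finset.mem_insert, Finset.mem_singleton] at hj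
    rcases hj with rfl | rfl | rfl | rfl <;>
      exact ⟨by omega, hval _ _ (by simp) (by simp)⟩)
  rw [Finset.card_insert_of_notMem, Finset.card_insert_of_notMem,
    Finset.card_insert_of_notMem, Finset.card_singleton] at this
  · omega
  all_goals
    simp only [Finset.mem_insert, Finset.mem_singleton]
    omega

theorem not_chooseCountLE_three_mul_add_two {w : ℕ} (hw : 0 < w) :
    ¬ ChooseCountLE (3 * w + 2) 4 := by
  intro h
  have hval : ∀ b s, b = 0 ∨ b = w → s < 3 → ¬ 3 ∣ (3 * w + 2).choose (3 * b + s) := by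
    intro b s hb hs
    rw [three_dvd_choose_iff (by norm_num) (by omega)]
    rcases hb with rfl | rfl <;> interval_cases s <;> simp
  have := h {3 * 0 + 0, 3 * 0 + 1, 3 * 0 + 2, 3 * w + 0, 3 * w + 1} (by
    intro j hj
    simp only [Finset.mem_insert, Finset.mem_singleton] at hj
    rcases hj with rfl | rfl | rfl | rfl | rfl <;>
      exact ⟨by omega, hval _ _ (by simp) (by norm_num)⟩)
  rw [Finset.card_insert_of_notMem, Finset.card_insert_of_notMem, Finset.card_insert_of_notMem,
    Finset.card_insert_of_notMem, Finset.card_singleton] at this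
  · omega
  all_goals
    simp only [Finset.mem_insert, Finset.mem_singleton]
    omega

theorem ChooseCountLE.mono {m n n' : ℕ} (h : ChooseCountLE m n) (hn : n ≤ n') :
    ChooseCountLE m n' := fun S hS => (h S hS).trans hn

theorem not_chooseCountLE_two : ¬ ChooseCountLE 2 2 := by
  intro h
  have := h {0, 1, 2} (by decide)
  simp at this

/-- At most three binomial coefficients prime to three. -/
theorem ChooseCountLE.classify_three {m : ℕ} (h : ChooseCountLE m 3) :
    m = 0 ∨ (∃ e, m = 3 ^ e) ∨ ∃ e, m = 2 * 3 ^ e := by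
  induction m using Nat.strong_induction_on with
  | _ m ih =>
  obtain ⟨w, r, hr, rfl⟩ : ∃ w r, r < 3 ∧ m = 3 * w + r := ⟨m / 3, m % 3, by omega, by omega⟩
  rcases Nat.eq_zero_or_pos w with rfl | hw
  · interval_cases r
    · exact Or.inl rfl
    · exact Or.inr (Or.inl ⟨0, rfl⟩)
    · exact Or.inr (Or.inr ⟨0, rfl⟩)
  · interval_cases r
    · rcases ih w (by omega) h.of_three_mul with rfl | ⟨e, rfl⟩ | ⟨e, rfl⟩
      · exact Or.inl rfl
      · exact Or.inr (Or.inl ⟨e + 1, by ring⟩)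
      · exact Or.inr (Or.inr ⟨e + 1, by ring⟩)
    · exact (not_chooseCountLE_three_mul_add_one hw h).elim
    · exact (not_chooseCountLE_three_mul_add_two hw (h.mono (by norm_num))).elim

/-- At most two binomial coefficients prime to three. -/
theorem ChooseCountLE.classify_two {m : ℕ} (h : ChooseCountLE m 2) :
    m = 0 ∨ ∃ e, m = 3 ^ e := by
  rcases (h.mono (by norm_num : 2 ≤ 3)).classify_three with rfl | h1 | ⟨e, rfl⟩
  · exact Or.inl rfl
  · exact Or.inr h1
  · exfalso
    induction e with
    | zero => exact not_chooseCountLE_two h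
    | succ e ih =>
      refine ih (ChooseCountLE.of_three_mul ?_)
      rwa [mul_left_comm, ← pow_succ']

/-- At most four binomial coefficients prime to three. -/
theorem ChooseCountLE.classify_four {m : ℕ} (h : ChooseCountLE m 4) :
    m = 0 ∨ (∃ e, m = 3 ^ e) ∨ (∃ e, m = 2 * 3 ^ e) ∨ ∃ e f, e < f ∧ m = 3 ^ e + 3 ^ f := by
  induction m using Nat.strong_induction_on with
  | _ m ih =>
  obtain ⟨w, r, hr, rfl⟩ : ∃ w r, r < 3 ∧ m = 3 * w + r := ⟨m / 3, m % 3, by omega, by omega⟩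
  rcases Nat.eq_zero_or_pos w with rfl | hw
  · interval_cases r
    · exact Or.inl rfl
    · exact Or.inr (Or.inl ⟨0, rfl⟩)
    · exact Or.inr (Or.inr (Or.inl ⟨0, rfl⟩))
  · interval_cases r
    · rcases ih w (by omega) h.of_three_mul with rfl | ⟨e, rfl⟩ | ⟨e, rfl⟩ | ⟨e, f, hef, rfl⟩
      · exact Or.inl rfl
      · exact Or.inr (Or.inl ⟨e + 1, by ring⟩)
      · exact Or.inr (Or.inr (Or.inl ⟨e + 1, by ring⟩))
      · exact Or.inr (Or.inr (Or.inr ⟨e + 1, f + 1, by omega, by ring⟩))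
    · rcases (h.of_three_mul_add_one (n := 2)).classify_two with rfl | ⟨f, rfl⟩
      · omega
      · exact Or.inr (Or.inr (Or.inr ⟨0, f + 1, by omega, by ring⟩))
    · exact (not_chooseCountLE_three_mul_add_two hw h).elim

theorem not_three_dvd_choose_two_mul (e : ℕ) : ¬ 3 ∣ (2 * 3 ^ e).choose (3 ^ e) := by
  have := three_dvd_choose_three_pow_mul_iff (a := 2) (b := 1) e
  rw [mul_one, mul_comm] at this
  rw [this]
  decide

theorem not_three_dvd_choose_add {e f : ℕ} (hef : e < f) :
    ¬ 3 ∣ (3 ^ e + 3 ^ f).choose (3 ^ e) := by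
  obtain ⟨d, rfl⟩ := Nat.exists_eq_add_of_lt hef
  have := three_dvd_choose_three_pow_mul_iff (a := 3 * 3 ^ d + 1) (b := 3 * 0 + 1) e
  rw [three_dvd_choose_iff (by norm_num) (by norm_num)] at this
  have h1 : 3 ^ e * (3 * 3 ^ d + 1) = 3 ^ e + 3 ^ (e + d + 1) := by ring
  rw [h1] at this
  simpa using this

end Lucas

section Support
variable {k V : Type*} [Field k] [Infinite k] [AddCommGroup V] [Module k V]
variable {ρ : SpecialLinearGroup (Fin 2) k →* Module.End k V} {m : ℕ} {c : ℕ → V}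

/-- The representation `ρ` is given by the matrices `T` on the independent vectors `b`. -/
def ActsBy {n : ℕ} (ρ : SpecialLinearGroup (Fin 2) k →* Module.End k V) (b : Fin n → V)
    (T : SpecialLinearGroup (Fin 2) k → Matrix (Fin n) (Fin n) k) : Prop :=
  LinearIndependent k b ∧ ∀ A j, ρ A (b j) = ∑ i, T A i j • b i

theorem IsEquivariantForm.actsBy (h : IsEquivariantForm ρ m c) {n : ℕ} {idx : Fin n → ℕ}
    (hidx : Function.Injective idx) (hle : ∀ i, idx i ≤ m) {κ : Fin n → k}
    (hκ : ∀ i, κ i ≠ 0) (hc : ∀ i, c (idx i) ≠ 0)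
    (h0 : ∀ j ≤ m, (∀ i, idx i ≠ j) → c j = 0)
    {T : SpecialLinearGroup (Fin 2) k → Matrix (Fin n) (Fin n) k}
    (hT : ∀ A : SpecialLinearGroup (Fin 2) k, ∀ i y, κ i * ((A.1 0 0 + A.1 0 1 * y) ^ (m - idx i) *
      (A.1 1 0 + A.1 1 1 * y) ^ idx i) = ∑ j, T A i j * (κ j * y ^ idx j)) :
    ActsBy ρ (fun i => (κ i)⁻¹ • c (idx i)) T := by
  refine ⟨?_, fun A j =>
    h.apply_eq_sum (b := fun i => (κ i)⁻¹ • c (idx i)) hidx hle hκ ?_ h0 A (hT A) j⟩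
  · have hS := h.linearIndepOn (S := Finset.univ.image idx) (by
      intro j hj
      obtain ⟨i, -, rfl⟩ := Finset.mem_image.1 hj
      exact ⟨hle i, hc i⟩)
    have h1 := hS.linearIndependent.comp
      (fun i : Fin n => (⟨idx i, by simp⟩ : (Finset.univ.image idx : Finset ℕ)))
      (fun a b hab => hidx (by simpa using hab))
    exact h1.units_smul (fun i => (Units.mk0 (κ i) (hκ i))⁻¹)
  · intro i
    rw [smul_smul, mul_inv_cancel₀ (hκ i), one_smul]

theorem IsEquivariantForm.eq_zero_of_finrank_le [FiniteDimensional k V]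
    (h : IsEquivariantForm ρ m c) {n : ℕ} (hn : Module.finrank k V ≤ n) {idx : Fin n → ℕ}
    (hidx : Function.Injective idx) (hle : ∀ i, idx i ≤ m) (hc : ∀ i, c (idx i) ≠ 0)
    {j : ℕ} (hj : j ≤ m) (hne : ∀ i, idx i ≠ j) : c j = 0 := by
  by_contra hcj
  have hnot : j ∉ Finset.univ.image idx := by simpa using hne
  have := h.card_le_finrank (S := insert j (Finset.univ.image idx)) (by
    intro l hl
    rcases Finset.mem_insert.1 hl with rfl | hl
    · exact ⟨hj, hcj⟩
    · obtain ⟨i, -, rfl⟩ := Finset.mem_image.1 hl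
      exact ⟨hle i, hc i⟩)
  rw [Finset.card_insert_of_notMem hnot, Finset.card_image_of_injective _ hidx,
    Finset.card_fin] at this
  omega

/-- A form of degree `2 q` on a four-dimensional space which is nonzero at `0` and `q` is supported
at `0`, `q` and `2 q`. -/
theorem IsEquivariantForm.eq_zero_of_degree_two_mul [FiniteDimensional k V]
    (hV : Module.finrank k V ≤ 4) {q : ℕ} (hq : 0 < q) (h : IsEquivariantForm ρ (2 * q) c)
    (h0 : c 0 ≠ 0) (h1 : c q ≠ 0) {j : ℕ} (hj : j ≤ 2 * q) (hj0 : j ≠ 0) (hj1 : j ≠ q)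
    (hj2 : j ≠ 2 * q) : c j = 0 := by
  by_contra hcj
  have h2 := h.ne_zero_symm (Nat.zero_le _) h0
  have h3 := h.ne_zero_symm hj hcj
  have := h.card_le_finrank (S := {0, q, 2 * q - 0, j, 2 * q - j}) (by
    intro l hl
    simp only [Finset.mem_insert, Finset.mem_singleton] at hl
    rcases hl with rfl | rfl | rfl | rfl | rfl <;> refine ⟨by omega, by assumption⟩)
  rw [Finset.card_insert_of_notMem, Finset.card_insert_of_notMem, Finset.card_insert_of_notMem,
    Finset.card_insert_of_notMem, Finset.card_singleton] at this
  · omega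
  all_goals
    simp only [Finset.mem_insert, Finset.mem_singleton]
    omega

theorem IsEquivariantForm.chooseCountLE_of_interior [CharP k 3] [FiniteDimensional k V]
    (hV : Module.finrank k V ≤ 4) (h : IsEquivariantForm ρ m c) (h0 : c 0 ≠ 0) {j : ℕ}
    (hj : 0 < j) (hjm : 2 * j < m) (hcj : c j ≠ 0) : ChooseCountLE (m - j) 3 := by
  have h1 := h.ne_zero_symm (Nat.zero_le _) h0
  have h2 := h.ne_zero_symm (by omega : j ≤ m) hcj
  have hsupp : ∀ l ≤ m, c l ≠ 0 → l = 0 ∨ l = j ∨ l = m - j ∨ l = m := by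
    intro l hl hcl
    by_contra! hcon
    have := h.card_le_finrank (S := {0, j, m - j, m - 0, l}) (by
      intro l hl
      simp only [Finset.mem_insert, Finset.mem_singleton] at hl
      rcases hl with rfl | rfl | rfl | rfl | rfl <;> refine ⟨by omega, by assumption⟩)
    rw [Finset.card_insert_of_notMem, Finset.card_insert_of_notMem, Finset.card_insert_of_notMem,
      Finset.card_insert_of_notMem, Finset.card_singleton] at this
    · omega
    all_goals
      simp only [Finset.mem_insert, Finset.mem_singleton]
      omega
  intro S hS
  have hsub : S ⊆ {0, m - 2 * j, m - j} := by
    intro i hi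
    obtain ⟨hi1, hi2⟩ := hS i hi
    have : c (j + i) ≠ 0 := by
      intro hz
      have := h.choose_eq_zero (by omega : j ≤ j + i) (by omega) hcj hz
      rw [CharP.cast_eq_zero_iff k 3, Nat.add_sub_cancel_left] at this
      exact hi2 this
    have := hsupp _ (by omega) this
    simp only [Finset.mem_insert, Finset.mem_singleton]
    omega
  exact (Finset.card_le_card hsub).trans Finset.card_le_three

/-- A form of degree `3 ^ e` on a four-dimensional space which does not only involve the extreme
weights involves exactly the weights of the symmetric cube, twisted. -/
theorem IsEquivariantForm.exists_of_interior [CharP k 3] [FiniteDimensional k V]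
    (hV : Module.finrank k V ≤ 4) {e : ℕ} (h : IsEquivariantForm ρ (3 ^ e) c) (h0 : c 0 ≠ 0)
    {j : ℕ} (hj : 0 < j) (hjm : j < 3 ^ e) (hcj : c j ≠ 0) :
    ∃ f, e = f + 1 ∧ c (3 ^ f) ≠ 0 ∧ c (2 * 3 ^ f) ≠ 0 := by
  have hodd : Odd (3 ^ e) := Odd.pow (by decide)
  wlog hlt : 2 * j < 3 ^ e generalizing j with H
  · obtain ⟨l, hl⟩ := hodd
    exact H (j := 3 ^ e - j) (by omega) (by omega) (h.ne_zero_symm hjm.le hcj) (by omega)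
  have hcj' := h.ne_zero_symm hjm.le hcj
  rcases (h.chooseCountLE_of_interior hV h0 hj hlt hcj).classify_three with h1 | ⟨g, hg⟩ | ⟨g, hg⟩
  · omega
  · exfalso
    have hge : g < e := (Nat.pow_lt_pow_iff_right (by norm_num : 1 < 3)).1 (by omega)
    obtain ⟨d, rfl⟩ := Nat.exists_eq_add_of_lt hge
    have : 3 ^ (g + 1) ≤ 3 ^ (g + d + 1) := Nat.pow_le_pow_right (by norm_num) (by omega)
    rw [pow_succ] at this
    omega
  · have hge : g < e := (Nat.pow_lt_pow_iff_right (by norm_num : 1 < 3)).1 (by omega)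
    obtain ⟨d, rfl⟩ := Nat.exists_eq_add_of_lt hge
    have hg0 : 0 < 3 ^ g := by positivity
    have hd : d = 0 := by
      by_contra hd
      have : 3 ^ (g + 1 + 1) ≤ 3 ^ (g + d + 1) := Nat.pow_le_pow_right (by norm_num) (by omega)
      rw [pow_succ, pow_succ] at this
      omega
    subst hd
    simp only [add_zero, pow_succ] at hg hcj'
    refine ⟨g, rfl, ?_, ?_⟩
    · have : j = 3 ^ g := by omega
      rwa [this] at hcj
    · rwa [hg] at hcj'

end Support

section Restriction
variable {k V : Type*} [Field k] [AddCommGroup V] [Module k V]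

/-- The restriction of a representation to an invariant subspace. -/
def restrictRep (ρ : SpecialLinearGroup (Fin 2) k →* Module.End k V) (K : Submodule k V)
    (hK : ∀ A, ∀ w ∈ K, ρ A w ∈ K) : SpecialLinearGroup (Fin 2) k →* Module.End k K where
  toFun A := (ρ A).restrict (hK A)
  map_one' := by
    ext w
    simp [LinearMap.restrict_apply]
  map_mul' A B := by
    ext w
    simp [LinearMap.restrict_apply]

variable {ρ : SpecialLinearGroup (Fin 2) k →* Module.End k V}

theorem restrictRep_apply {K : Submodule k V} (hK : ∀ A, ∀ w ∈ K, ρ A w ∈ K)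
    (A : SpecialLinearGroup (Fin 2) k) (w : K) : (restrictRep ρ K hK A w : V) = ρ A w := rfl

theorem IsRegularMap.restrictRep (hρ : IsRegularMap (fun A => ρ A)) {K : Submodule k V}
    (hK : ∀ A, ∀ w ∈ K, ρ A w ∈ K) : IsRegularMap (fun A => _root_.restrictRep ρ K hK A) := by
  obtain ⟨π, hπ⟩ := K.subtype.exists_leftInverse_of_injective K.ker_subtype
  have h := hρ.map (W := Module.End k K)
    ((LinearMap.llcomp k K V K π) ∘ₗ LinearMap.lcomp k V K.subtype)
  convert h using 1
  ext A w
  have h1 := LinearMap.congr_fun hπ (_root_.restrictRep ρ K hK A w)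
  simp only [LinearMap.comp_apply, LinearMap.id_apply] at h1
  rw [← h1]
  rfl

/-- The common kernel of the nonzero coefficients of a form on the dual space is invariant. -/
theorem IsEquivariantForm.ker_invariant [Infinite k] {m : ℕ} {ξ : ℕ → Module.Dual k V}
    (h : IsEquivariantForm (transposeDual ρ) m ξ) {n : ℕ} {idx : Fin n → ℕ}
    (hle : ∀ i, idx i ≤ m) (h0 : ∀ j ≤ m, (∀ i, idx i ≠ j) → ξ j = 0)
    (A : SpecialLinearGroup (Fin 2) k) (w : V)
    (hw : w ∈ LinearMap.ker (LinearMap.pi fun i => ξ (idx i))) :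
    ρ A w ∈ LinearMap.ker (LinearMap.pi fun i => ξ (idx i)) := by
  simp only [LinearMap.mem_ker, funext_iff, LinearMap.pi_apply, Pi.zero_apply] at hw ⊢
  have hw' : ∀ j ≤ m, ξ j w = 0 := by
    intro j hj
    by_cases hex : ∃ i, idx i = j
    · obtain ⟨i, rfl⟩ := hex
      exact hw i
    · push Not at hex
      rw [h0 j hj hex, LinearMap.zero_apply]
  intro i
  refine eq_of_sum_range_pow_smul_eq (k := k) (n := m + 1) (x := fun j => ξ j (ρ A w))
    (y := fun _ => 0) ?_ (Nat.lt_succ_of_le (hle i))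
  intro y _
  have h1 := congrArg (fun f => f w) (h.apply_sum A.transpose y)
  simp only [LinearMap.sum_apply, LinearMap.smul_apply, transposeDual_apply, binaryForm] at h1
  have htr : A.transpose.transpose = A := Subtype.ext (Matrix.transpose_transpose A.1)
  rw [htr] at h1
  rw [h1]
  simp only [smul_zero, Finset.sum_const_zero]
  refine Finset.sum_eq_zero fun j hj => ?_
  rw [hw' j (Nat.lt_succ_iff.1 (Finset.mem_range.1 hj)), smul_zero]

theorem finrank_ker_pi_add [FiniteDimensional k V] {n : ℕ} {φ : Fin n → Module.Dual k V}
    {b : Fin n → V} {μ : Fin n → k} (hμ : ∀ i, μ i ≠ 0)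
    (hφ : ∀ i j, φ i (b j) = if i = j then μ j else 0) :
    n + Module.finrank k (LinearMap.ker (LinearMap.pi φ)) = Module.finrank k V := by
  have hsurj : Function.Surjective (LinearMap.pi φ) := by
    intro x
    refine ⟨∑ j, (x j * (μ j)⁻¹) • b j, ?_⟩
    ext i
    simp [hφ, hμ]
  have := LinearMap.finrank_range_add_finrank_ker (LinearMap.pi φ)
  rw [LinearMap.range_eq_top.2 hsurj, finrank_top, Module.finrank_fin_fun] at this
  exact this

end Restriction

theorem injective_vec_two {a b : ℕ} (hab : a ≠ b) : Function.Injective ![a, b] := by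
  intro i j hij
  fin_cases i <;> fin_cases j <;> simp at hij ⊢ <;> omega

theorem injective_vec_three {a b c : ℕ} (hab : a ≠ b) (hac : a ≠ c) (hbc : b ≠ c) :
    Function.Injective ![a, b, c] := by
  intro i j hij
  fin_cases i <;> fin_cases j <;> simp at hij ⊢ <;> omega

theorem injective_vec_four {a b c d : ℕ} (hab : a ≠ b) (hac : a ≠ c) (had : a ≠ d) (hbc : b ≠ c)
    (hbd : b ≠ d) (hcd : c ≠ d) : Function.Injective ![a, b, c, d] := by
  intro i j hij
  fin_cases i <;> fin_cases j <;> simp at hij ⊢ <;> omega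

section SmallRank
variable {k V : Type*} [Field k] [CharP k 3] [AddCommGroup V] [Module k V]
variable {ρ : SpecialLinearGroup (Fin 2) k →* Module.End k V}

theorem ne_zero_of_pairing {m : ℕ} {v : ℕ → V} {ξ : ℕ → Module.Dual k V}
    (h : ∀ i ≤ m, ∀ j ≤ m, ξ i (v j) = if i = j then (m.choose j : k) else 0) {j : ℕ}
    (hj : j ≤ m) (hc : ¬ 3 ∣ m.choose j) : v j ≠ 0 ∧ ξ j ≠ 0 := by
  have h1 := h j hj j hj
  rw [if_pos rfl] at h1
  have h2 : (m.choose j : k) ≠ 0 := fun h0 => hc ((CharP.cast_eq_zero_iff k 3 _).1 h0)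
  constructor
  · intro h0
    rw [h0, map_zero] at h1
    exact h2 h1.symm
  · intro h0
    rw [h0, LinearMap.zero_apply] at h1
    exact h2 h1.symm

theorem entryPow_transform (e : ℕ) (A : Matrix (Fin 2) (Fin 2) k) (i : Fin 2) (y : k) :
    (1 : k) * ((A 0 0 + A 0 1 * y) ^ (3 ^ e - ![0, 3 ^ e] i) *
      (A 1 0 + A 1 1 * y) ^ (![0, 3 ^ e] i : ℕ)) =
        ∑ j, entryPow A (3 ^ e) i j * (1 * y ^ (![0, 3 ^ e] j : ℕ)) := by
  fin_cases i <;> simp [entryPow, add_pow_char_pow, mul_pow]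

variable [Infinite k]

/-- If only the extreme weights of a form of degree `3 ^ e` occur, they span a twist of the
standard representation. -/
theorem IsEquivariantForm.actsBy_entryPow {e : ℕ} {c : ℕ → V}
    (h : IsEquivariantForm ρ (3 ^ e) c) (h0 : c 0 ≠ 0)
    (hz : ∀ j, 0 < j → j < 3 ^ e → c j = 0) :
    ActsBy ρ ![c 0, c (3 ^ e)] (fun A => entryPow A.1 (3 ^ e)) := by
  have hpos : 0 < 3 ^ e := by positivity
  have h1 := h.ne_zero_symm (Nat.zero_le _) h0
  have := h.actsBy (idx := ![0, 3 ^ e]) (κ := fun _ => 1) (T := fun A => entryPow A.1 (3 ^ e))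
    (injective_vec_two hpos.ne)
    (by simp [Fin.forall_fin_two]) (by simp) (by simpa [Fin.forall_fin_two] using ⟨h0, h1⟩)
    (by
      intro j hj hne
      simp only [Fin.forall_fin_two, Matrix.cons_val_zero, Matrix.cons_val_one] at hne
      exact hz j (by omega) (by omega))
    (fun A i y => entryPow_transform e A.1 i y)
  convert this using 1
  ext i
  fin_cases i <;> simp

variable [FiniteDimensional k V]

theorem chooseCountLE_finrank {m : ℕ} {v : ℕ → V} {ξ : ℕ → Module.Dual k V}
    (hv : IsEquivariantForm ρ m v)
    (h : ∀ i ≤ m, ∀ j ≤ m, ξ i (v j) = if i = j then (m.choose j : k) else 0) :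
    ChooseCountLE m (Module.finrank k V) :=
  fun _ hS => hv.card_le_finrank fun j hj =>
    ⟨(hS j hj).1, (ne_zero_of_pairing h (hS j hj).1 (hS j hj).2).1⟩

/-- One-dimensional representations are trivial. -/
theorem eq_one_of_finrank_one (hρ : IsRegularMap (fun A => ρ A)) (hV : Module.finrank k V = 1)
    (A : SpecialLinearGroup (Fin 2) k) : ρ A = 1 := by
  have : Nontrivial V := Module.nontrivial_of_finrank_pos (R := k) (by omega)
  obtain ⟨m, v, ξ, hv, -, hp, htriv⟩ := exists_highestWeight hρ
  refine htriv ?_ A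
  by_contra hm
  have := chooseCountLE_finrank hv hp {0, m} (by
    intro j hj
    simp only [Finset.mem_insert, Finset.mem_singleton] at hj
    rcases hj with rfl | rfl <;> simp)
  rw [hV, Finset.card_pair (Ne.symm hm)] at this
  omega

/-- A two-dimensional representation is trivial or a twist of the standard one. -/
theorem classify_finrank_two (hρ : IsRegularMap (fun A => ρ A)) (hV : Module.finrank k V = 2) :
    (∀ A, ρ A = 1) ∨ ∃ (e : ℕ) (b : Fin 2 → V), ActsBy ρ b (fun A => entryPow A.1 (3 ^ e)) := by
  have : Nontrivial V := Module.nontrivial_of_finrank_pos (R := k) (by omega)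
  obtain ⟨m, v, ξ, hv, -, hp, htriv⟩ := exists_highestWeight hρ
  have hcount := chooseCountLE_finrank hv hp
  rw [hV] at hcount
  rcases hcount.classify_two with h0 | ⟨e, rfl⟩
  · exact Or.inl (htriv h0)
  · have hpos : 0 < 3 ^ e := by positivity
    have h0 := (ne_zero_of_pairing hp (Nat.zero_le _) (by simp)).1
    have h1 := (ne_zero_of_pairing hp le_rfl (by simp)).1
    refine Or.inr ⟨e, _, hv.actsBy_entryPow h0 fun j hj hj' => ?_⟩
    refine hv.eq_zero_of_finrank_le hV.le (idx := ![0, 3 ^ e]) ?_ ?_ ?_ hj'.le ?_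
    · exact injective_vec_two hpos.ne
    · simp [Fin.forall_fin_two]
    · simpa [Fin.forall_fin_two] using ⟨h0, h1⟩
    · simp only [Fin.forall_fin_two, Matrix.cons_val_zero, Matrix.cons_val_one]
      omega

end SmallRank

section Transform
variable {k : Type*} [Field k] [CharP k 3]

theorem frobenius_det (e : ℕ) (A : SpecialLinearGroup (Fin 2) k) :
    A.1 0 0 ^ 3 ^ e * A.1 1 1 ^ 3 ^ e - A.1 0 1 ^ 3 ^ e * A.1 1 0 ^ 3 ^ e = 1 := by
  rw [← mul_pow, ← mul_pow, ← sub_pow_char_pow, SLTwo.det_eq, one_pow]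

theorem three_eq_zero_of_charP_three : (3 : k) = 0 := by
  exact_mod_cast CharP.cast_eq_zero k 3

theorem two_ne_zero_of_charP_three : (2 : k) ≠ 0 := by
  intro h
  have h3 := three_eq_zero_of_charP_three (k := k)
  exact one_ne_zero (by linear_combination h3 - h : (1 : k) = 0)

theorem inv_two_of_charP_three : (2 : k)⁻¹ = 2 := by
  refine inv_eq_of_mul_eq_one_left ?_
  linear_combination three_eq_zero_of_charP_three (k := k)

theorem kron4_transform (e₁ e₂ : ℕ) (A : Matrix (Fin 2) (Fin 2) k) (i : Fin 4) (y : k) :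
    (1 : k) * ((A 0 0 + A 0 1 * y) ^ (3 ^ e₁ + 3 ^ e₂ - ![0, 3 ^ e₁, 3 ^ e₂, 3 ^ e₁ + 3 ^ e₂] i) *
      (A 1 0 + A 1 1 * y) ^ (![0, 3 ^ e₁, 3 ^ e₂, 3 ^ e₁ + 3 ^ e₂] i : ℕ)) =
        ∑ j, kron4 (entryPow A (3 ^ e₂)) (entryPow A (3 ^ e₁)) i j *
          (1 * y ^ (![0, 3 ^ e₁, 3 ^ e₂, 3 ^ e₁ + 3 ^ e₂] j : ℕ)) := by
  fin_cases i <;>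
    simp [Fin.sum_univ_four, kron4, entryPow, add_pow_char_pow, mul_pow, pow_add] <;> ring

theorem famIX_transform (e : ℕ) (A : SpecialLinearGroup (Fin 2) k) (i : Fin 3) (y : k) :
    (![1, 2, 1] i : k) * ((A.1 0 0 + A.1 0 1 * y) ^ (2 * 3 ^ e - ![0, 3 ^ e, 2 * 3 ^ e] i) *
      (A.1 1 0 + A.1 1 1 * y) ^ (![0, 3 ^ e, 2 * 3 ^ e] i : ℕ)) =
        ∑ j, (famIX k (3 ^ e) A).submatrix Fin.castSucc Fin.castSucc i j *
          (![1, 2, 1] j * y ^ (![0, 3 ^ e, 2 * 3 ^ e] j : ℕ)) := by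
  have hsub : 3 ^ e * 2 - 3 ^ e = 3 ^ e := by omega
  fin_cases i <;>
    simp [Fin.sum_univ_three, famIX, hsub, add_pow_char_pow, mul_pow, mul_comm 2 (3 ^ e), pow_mul]
    <;> ring

theorem famVII_transform (e : ℕ) (A : SpecialLinearGroup (Fin 2) k) (i : Fin 4) (y : k) :
    (![1 / 2, 1, 1, 1] i : k) * ((A.1 0 0 + A.1 0 1 * y) ^
        (3 ^ (e + 1) - ![3 ^ e, 2 * 3 ^ e, 0, 3 ^ (e + 1)] i) *
      (A.1 1 0 + A.1 1 1 * y) ^ (![3 ^ e, 2 * 3 ^ e, 0, 3 ^ (e + 1)] i : ℕ)) =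
        ∑ j, famVII k (3 ^ e) A i j *
          (![1 / 2, 1, 1, 1] j * y ^ (![3 ^ e, 2 * 3 ^ e, 0, 3 ^ (e + 1)] j : ℕ)) := by
  have hs1 : 3 ^ e * 3 - 3 ^ e = 3 ^ e * 2 := by omega
  have hs2 : 3 ^ e * 3 - 3 ^ e * 2 = 3 ^ e := by omega
  have hdet := frobenius_det e A
  have h3 := three_eq_zero_of_charP_three (k := k)
  have hinv := inv_two_of_charP_three (k := k)
  fin_cases i <;>
    simp [Fin.sum_univ_four, famVII, hs1, hs2, add_pow_char_pow, mul_pow, mul_comm 2 (3 ^ e),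
      mul_comm 3 (3 ^ e), pow_succ 3, pow_mul, hinv] <;>
    generalize A.1 0 0 ^ 3 ^ e = a at * <;> generalize A.1 0 1 ^ 3 ^ e = b at * <;>
    generalize A.1 1 0 ^ 3 ^ e = c at * <;> generalize A.1 1 1 ^ 3 ^ e = d at * <;>
    generalize y ^ 3 ^ e = z at *
  · linear_combination (2 * a * z + 4 * b * z ^ 2) * hdet +
      (2 * a * b * c * z + (2 * b ^ 2 * c + b) * z ^ 2) * h3
  · linear_combination (2 * c * z + d * z ^ 2) * hdet + (b * c ^ 2 * z + b * c * d * z ^ 2) * h3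
  · linear_combination (a ^ 2 * b * z + a * b ^ 2 * z ^ 2) * h3
  · linear_combination (c ^ 2 * d * z + c * d ^ 2 * z ^ 2) * h3

theorem famII_transform (e : ℕ) (A : SpecialLinearGroup (Fin 2) k) (i : Fin 4) (y : k) :
    (![1, 1, 1, 1 / 2] i : k) * ((A.1 0 0 + A.1 0 1 * y) ^
        (3 ^ (e + 1) - ![0, 3 ^ (e + 1), 3 ^ e, 2 * 3 ^ e] i) *
      (A.1 1 0 + A.1 1 1 * y) ^ (![0, 3 ^ (e + 1), 3 ^ e, 2 * 3 ^ e] i : ℕ)) =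
        ∑ j, (famII k (3 ^ e) A.transpose)ᵀ i j *
          (![1, 1, 1, 1 / 2] j * y ^ (![0, 3 ^ (e + 1), 3 ^ e, 2 * 3 ^ e] j : ℕ)) := by
  have hs1 : 3 ^ e * 3 - 3 ^ e = 3 ^ e * 2 := by omega
  have hs2 : 3 ^ e * 3 - 3 ^ e * 2 = 3 ^ e := by omega
  have hdet := frobenius_det e A
  have h3 := three_eq_zero_of_charP_three (k := k)
  have hinv := inv_two_of_charP_three (k := k)
  fin_cases i <;>
    simp [Fin.sum_univ_four, famII, hs1, hs2, add_pow_char_pow, mul_pow, mul_comm 2 (3 ^ e),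
      mul_comm 3 (3 ^ e), pow_succ 3, pow_mul, hinv] <;>
    generalize A.1 0 0 ^ 3 ^ e = a at * <;> generalize A.1 0 1 ^ 3 ^ e = b at * <;>
    generalize A.1 1 0 ^ 3 ^ e = c at * <;> generalize A.1 1 1 ^ 3 ^ e = d at * <;>
    generalize y ^ 3 ^ e = z at *
  · linear_combination (a ^ 2 * b * z + a * b ^ 2 * z ^ 2) * h3
  · linear_combination (c ^ 2 * d * z + c * d ^ 2 * z ^ 2) * h3
  · linear_combination (a * z + 2 * b * z ^ 2) * hdet + (a * b * c * z + b ^ 2 * c * z ^ 2) * h3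
  · linear_combination (4 * c * z + 2 * d * z ^ 2) * hdet +
      ((2 * b * c ^ 2 + c) * z + 2 * b * c * d * z ^ 2) * h3

end Transform

section ActsBy
variable {k V : Type*} [Field k] [AddCommGroup V] [Module k V]
variable {ρ : SpecialLinearGroup (Fin 2) k →* Module.End k V}

theorem ActsBy.of_transposeDual [FiniteDimensional k V] {n : ℕ} (hV : Module.finrank k V = n)
    {β : Fin n → Module.Dual k V}
    {T : SpecialLinearGroup (Fin 2) k → Matrix (Fin n) (Fin n) k}
    (h : ActsBy (transposeDual ρ) β (fun A => (T A.transpose)ᵀ)) : ∃ b, ActsBy ρ b T := by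
  let B : Module.Basis (Fin n) k (Module.Dual k V) :=
    Module.Basis.mk h.1 (h.1.span_eq_top_of_card_eq_finrank' (by
      rw [Fintype.card_fin, Subspace.dual_finrank_eq, hV])).ge
  have hB : ∀ i, B i = β i := fun i => by simp [B]
  let b : Module.Basis (Fin n) k V := B.dualBasis.map (Module.evalEquiv k V).symm
  have hb : ∀ i j, β i (b j) = if j = i then 1 else 0 := by
    intro i j
    have : Module.evalEquiv k V (b j) = B.dualBasis j := by simp [b]
    have h1 : β i (b j) = Module.evalEquiv k V (b j) (β i) := rfl
    rw [h1, this, ← hB, Module.Basis.dualBasis_apply_self]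
    simp [eq_comm]
  refine ⟨b, b.linearIndependent, fun A j => ?_⟩
  have hext : ∀ x y : V, (∀ i, β i x = β i y) → x = y := by
    intro x y hxy
    refine (Module.evalEquiv k V).injective (B.ext fun i => ?_)
    simpa [hB] using hxy i
  refine hext _ _ fun l => ?_
  have htr : A.transpose.transpose = A := Subtype.ext (Matrix.transpose_transpose A.1)
  have h1 := congrArg (fun f => f (b j)) (h.2 A.transpose l)
  simp only [transposeDual_apply, htr, LinearMap.sum_apply, LinearMap.smul_apply,
    Matrix.transpose_apply, hb] at h1
  simp only [h1, map_sum, map_smul, hb]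
  simp

theorem ActsBy.subtype {K : Submodule k V} {hK : ∀ A, ∀ w ∈ K, ρ A w ∈ K} {n : ℕ}
    {b : Fin n → K} {T : SpecialLinearGroup (Fin 2) k → Matrix (Fin n) (Fin n) k}
    (h : ActsBy (restrictRep ρ K hK) b T) : ActsBy ρ (fun i => (b i : V)) T := by
  refine ⟨h.1.map' K.subtype K.ker_subtype, fun A j => ?_⟩
  have := congrArg (fun w : K => (w : V)) (h.2 A j)
  simpa [restrictRep_apply] using this

theorem actsBy_one_of_eq_one [FiniteDimensional k V] {n : ℕ} (hV : Module.finrank k V = n)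
    (h : ∀ A, ρ A = 1) : ∃ b : Fin n → V, ActsBy ρ b (fun _ => 1) := by
  refine ⟨Module.finBasisOfFinrankEq k V hV, Module.Basis.linearIndependent _, fun A j => ?_⟩
  simp [h, Matrix.one_apply]

theorem ActsBy.blockDiag4 {b c : Fin 2 → V}
    {X Y : SpecialLinearGroup (Fin 2) k → Matrix (Fin 2) (Fin 2) k} (hb : ActsBy ρ b X)
    (hc : ActsBy ρ c Y) (hli : LinearIndependent k ![b 0, b 1, c 0, c 1]) :
    ActsBy ρ ![b 0, b 1, c 0, c 1] (fun A => blockDiag4 (X A) (Y A)) := by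
  refine ⟨hli, fun A j => ?_⟩
  fin_cases j <;>
    simp [Fin.sum_univ_four, _root_.blockDiag4, hb.2, hc.2, Fin.sum_univ_two]

theorem linearIndependent_of_dual_pair {b c : Fin 2 → V} {φ : Fin 2 → Module.Dual k V}
    {μ : Fin 2 → k} (hμ : ∀ i, μ i ≠ 0) (hb : ∀ i j, φ i (b j) = if i = j then μ j else 0)
    (hc : ∀ i j, φ i (c j) = 0) (hli : LinearIndependent k c) :
    LinearIndependent k ![b 0, b 1, c 0, c 1] := by
  rw [Fintype.linearIndependent_iff]
  intro g hg
  simp only [Fin.sum_univ_four, Matrix.cons_val] at hg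
  have h0 : g 0 = 0 := by
    have := congrArg (φ 0) hg
    simpa [hb, hc, hμ] using this
  have h1 : g 1 = 0 := by
    have := congrArg (φ 1) hg
    simpa [hb, hc, hμ] using this
  have h2 := Fintype.linearIndependent_iff.1 hli ![g 2, g 3] (by
    simpa [h0, h1, Fin.sum_univ_two] using hg)
  simp only [Fin.forall_fin_two, Matrix.cons_val_zero, Matrix.cons_val_one] at h2
  simp only [Fin.forall_fin_succ, Fin.succ_zero_eq_one, Fin.succ_one_eq_two]
  exact ⟨h0, h1, h2.1, h2.2, by simp⟩

theorem linearIndependent_swap {b c : Fin 2 → V}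
    (h : LinearIndependent k ![b 0, b 1, c 0, c 1]) :
    LinearIndependent k ![c 0, c 1, b 0, b 1] := by
  have := h.comp ![2, 3, 0, 1] (by decide)
  convert this using 1
  ext i
  fin_cases i <;> rfl

end ActsBy

section FinrankFour
variable {k V : Type*} [Field k] [Infinite k] [CharP k 3] [AddCommGroup V] [Module k V]
  [FiniteDimensional k V]
variable {ρ : SpecialLinearGroup (Fin 2) k →* Module.End k V}

theorem actsBy_kron4 {e₁ e₂ : ℕ} (hV : Module.finrank k V = 4) (he : e₁ < e₂) {v : ℕ → V}
    {ξ : ℕ → Module.Dual k V} (hv : IsEquivariantForm ρ (3 ^ e₁ + 3 ^ e₂) v)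
    (hp : ∀ i ≤ 3 ^ e₁ + 3 ^ e₂, ∀ j ≤ 3 ^ e₁ + 3 ^ e₂,
      ξ i (v j) = if i = j then ((3 ^ e₁ + 3 ^ e₂).choose j : k) else 0) :
    ∃ b, ActsBy ρ b (fun A => kron4 (entryPow A.1 (3 ^ e₂)) (entryPow A.1 (3 ^ e₁))) := by
  have hpos : 0 < 3 ^ e₁ := by positivity
  have hlt : 3 ^ e₁ < 3 ^ e₂ := Nat.pow_lt_pow_right (by norm_num) he
  have h0 := (ne_zero_of_pairing hp (Nat.zero_le _) (by simp)).1
  have h1 := (ne_zero_of_pairing hp le_rfl (by simp)).1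
  have h2 := (ne_zero_of_pairing hp (by omega) (not_three_dvd_choose_add he)).1
  have h3 := hv.ne_zero_symm (by omega) h2
  rw [Nat.add_sub_cancel_left] at h3
  have hinj := injective_vec_four (a := 0) (b := 3 ^ e₁) (c := 3 ^ e₂) (d := 3 ^ e₁ + 3 ^ e₂)
    (by omega) (by omega) (by omega) (by omega) (by omega) (by omega)
  have hle : ∀ i, ![0, 3 ^ e₁, 3 ^ e₂, 3 ^ e₁ + 3 ^ e₂] i ≤ 3 ^ e₁ + 3 ^ e₂ := by
    simp [Fin.forall_fin_succ]
  have hne : ∀ i, v (![0, 3 ^ e₁, 3 ^ e₂, 3 ^ e₁ + 3 ^ e₂] i) ≠ 0 := by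
    simp [Fin.forall_fin_succ, h0, h1, h2, h3]
  exact ⟨_, hv.actsBy hinj hle (κ := fun _ => 1) (by simp) hne
    (fun j hj hj' => hv.eq_zero_of_finrank_le hV.le hinj hle hne hj hj')
    (fun A i y => kron4_transform e₁ e₂ A.1 i y)⟩

theorem actsBy_famVII {e : ℕ} (hV : Module.finrank k V = 4) {v : ℕ → V}
    (hv : IsEquivariantForm ρ (3 ^ (e + 1)) v) (h0 : v 0 ≠ 0) (h1 : v (3 ^ e) ≠ 0)
    (h2 : v (2 * 3 ^ e) ≠ 0) : ∃ b, ActsBy ρ b (famVII k (3 ^ e)) := by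
  have hpos : 0 < 3 ^ e := by positivity
  have hsucc : 3 ^ (e + 1) = 3 * 3 ^ e := by ring
  have h3 := hv.ne_zero_symm (Nat.zero_le _) h0
  rw [Nat.sub_zero] at h3
  have hinj := injective_vec_four (a := 3 ^ e) (b := 2 * 3 ^ e) (c := 0) (d := 3 ^ (e + 1))
    (by omega) (by omega) (by omega) (by omega) (by omega) (by omega)
  have hle : ∀ i, ![3 ^ e, 2 * 3 ^ e, 0, 3 ^ (e + 1)] i ≤ 3 ^ (e + 1) := by
    simp [Fin.forall_fin_succ]
    omega
  have hne : ∀ i, v (![3 ^ e, 2 * 3 ^ e, 0, 3 ^ (e + 1)] i) ≠ 0 := by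
    simp [Fin.forall_fin_succ, h0, h1, h2, h3]
  exact ⟨_, hv.actsBy hinj hle (κ := ![1 / 2, 1, 1, 1])
    (by simp [Fin.forall_fin_succ, two_ne_zero_of_charP_three]) hne
    (fun j hj hj' => hv.eq_zero_of_finrank_le hV.le hinj hle hne hj hj')
    (fun A i y => famVII_transform e A i y)⟩

theorem actsBy_famII {e : ℕ} (hV : Module.finrank k V = 4) {ξ : ℕ → Module.Dual k V}
    (hξ : IsEquivariantForm (transposeDual ρ) (3 ^ (e + 1)) ξ) (h0 : ξ 0 ≠ 0)
    (h1 : ξ (3 ^ e) ≠ 0) (h2 : ξ (2 * 3 ^ e) ≠ 0) : ∃ b, ActsBy ρ b (famII k (3 ^ e)) := by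
  have hpos : 0 < 3 ^ e := by positivity
  have hsucc : 3 ^ (e + 1) = 3 * 3 ^ e := by ring
  have h3 := hξ.ne_zero_symm (Nat.zero_le _) h0
  rw [Nat.sub_zero] at h3
  have hinj := injective_vec_four (a := 0) (b := 3 ^ (e + 1)) (c := 3 ^ e) (d := 2 * 3 ^ e)
    (by omega) (by omega) (by omega) (by omega) (by omega) (by omega)
  have hle : ∀ i, ![0, 3 ^ (e + 1), 3 ^ e, 2 * 3 ^ e] i ≤ 3 ^ (e + 1) := by
    simp [Fin.forall_fin_succ]
    omega
  have hne : ∀ i, ξ (![0, 3 ^ (e + 1), 3 ^ e, 2 * 3 ^ e] i) ≠ 0 := by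
    simp [Fin.forall_fin_succ, h0, h1, h2, h3]
  exact ActsBy.of_transposeDual hV (hξ.actsBy hinj hle (κ := ![1, 1, 1, 1 / 2])
    (by simp [Fin.forall_fin_succ, two_ne_zero_of_charP_three]) hne
    (fun j hj hj' => hξ.eq_zero_of_finrank_le (by rw [Subspace.dual_finrank_eq, hV]) hinj hle hne
      hj hj')
    (fun A i y => famII_transform e A i y))

theorem actsBy_famIX {e : ℕ} (hρ : IsRegularMap (fun A => ρ A)) (hV : Module.finrank k V = 4)
    {v : ℕ → V} {ξ : ℕ → Module.Dual k V} (hv : IsEquivariantForm ρ (2 * 3 ^ e) v)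
    (hξ : IsEquivariantForm (transposeDual ρ) (2 * 3 ^ e) ξ)
    (hp : ∀ i ≤ 2 * 3 ^ e, ∀ j ≤ 2 * 3 ^ e,
      ξ i (v j) = if i = j then ((2 * 3 ^ e).choose j : k) else 0) :
    ∃ b, ActsBy ρ b (famIX k (3 ^ e)) := by
  have hpos : 0 < 3 ^ e := by positivity
  obtain ⟨hv0, hξ0⟩ := ne_zero_of_pairing hp (Nat.zero_le _) (by simp)
  obtain ⟨hv1, hξ1⟩ := ne_zero_of_pairing hp (by omega) (not_three_dvd_choose_two_mul e)
  obtain ⟨hv2, hξ2⟩ := ne_zero_of_pairing hp le_rfl (by simp)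
  have hinj := injective_vec_three (a := 0) (b := 3 ^ e) (c := 2 * 3 ^ e)
    (by omega) (by omega) (by omega)
  have hle : ∀ i, ![0, 3 ^ e, 2 * 3 ^ e] i ≤ 2 * 3 ^ e := by
    simp [Fin.forall_fin_succ]
  have hcond : ∀ j : ℕ, (∀ i, ![0, 3 ^ e, 2 * 3 ^ e] i ≠ j) →
      j ≠ 0 ∧ j ≠ 3 ^ e ∧ j ≠ 2 * 3 ^ e := by
    intro j hj
    exact ⟨(hj 0).symm, (hj 1).symm, (hj 2).symm⟩
  have hact := hv.actsBy hinj hle (κ := ![1, 2, 1])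
    (by simp [Fin.forall_fin_succ, two_ne_zero_of_charP_three])
    (by simp [Fin.forall_fin_succ, hv0, hv1, hv2])
    (fun j hj hj' => hv.eq_zero_of_degree_two_mul hV.le hpos hv0 hv1 hj (hcond j hj').1
      (hcond j hj').2.1 (hcond j hj').2.2)
    (fun A i y => famIX_transform e A i y)
  have hK := hξ.ker_invariant hle (fun j hj hj' => hξ.eq_zero_of_degree_two_mul
      (by rw [Subspace.dual_finrank_eq, hV]) hpos hξ0 hξ1 hj (hcond j hj').1
      (hcond j hj').2.1 (hcond j hj').2.2)
  set φ : Fin 3 → Module.Dual k V := fun i => ξ (![0, 3 ^ e, 2 * 3 ^ e] i) with hφ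
  have hpair : ∀ i j, φ i (v (![0, 3 ^ e, 2 * 3 ^ e] j)) =
      if i = j then ((2 * 3 ^ e).choose (![0, 3 ^ e, 2 * 3 ^ e] j) : k) else 0 := by
    intro i j
    rw [hφ, hp _ (hle i) _ (hle j)]
    simp [hinj.eq_iff]
  have hμ : ∀ j, ((2 * 3 ^ e).choose (![0, 3 ^ e, 2 * 3 ^ e] j) : k) ≠ 0 := by
    intro j h0
    rw [CharP.cast_eq_zero_iff k 3] at h0
    fin_cases j
    · simp at h0
    · exact not_three_dvd_choose_two_mul e h0
    · simp at h0
  have hdim := finrank_ker_pi_add hμ hpair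
  have hrank : Module.finrank k (LinearMap.ker (LinearMap.pi φ)) = 1 := by omega
  have htriv := eq_one_of_finrank_one (hρ.restrictRep hK) hrank
  obtain ⟨w, hw⟩ := finrank_eq_one_iff'.1 hrank
  have hw0 : (w : V) ≠ 0 := fun h => hw.1 (Subtype.ext h)
  have hφw : ∀ i, φ i w = 0 := fun i => congrFun w.2 i
  have hwfix : ∀ A, ρ A w = w := by
    intro A
    rw [← restrictRep_apply hK, htriv A]
    rfl
  set b : Fin 3 → V := fun i => (![1, 2, 1] i : k)⁻¹ • v (![0, 3 ^ e, 2 * 3 ^ e] i) with hb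
  refine ⟨Fin.snoc b (w : V), ?_, ?_⟩
  · rw [linearIndependent_finSnoc]
    refine ⟨hact.1, fun hmem => hw0 ?_⟩
    obtain ⟨g, hg⟩ := (Submodule.mem_span_range_iff_exists_fun k).1 hmem
    have hg0 : ∀ i, g i = 0 := by
      intro i
      have := congrArg (φ i) hg
      rw [hφw, map_sum] at this
      simp only [hb, map_smul, hpair] at this
      simp [hμ] at this
      rcases this with h | h
      · exact h
      · exfalso
        fin_cases i <;> simp [two_ne_zero_of_charP_three] at h
    rw [← hg]
    simp [hg0]
  · intro A j
    refine Fin.lastCases ?_ (fun j => ?_) j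
    · rw [Fin.snoc_last, hwfix, Fin.sum_univ_castSucc]
      simp only [Fin.snoc_castSucc, Fin.snoc_last]
      simp [famIX, Fin.sum_univ_three]
    · rw [Fin.snoc_castSucc, hact.2, Fin.sum_univ_castSucc (n := 3)]
      simp only [Fin.snoc_castSucc, Fin.snoc_last, Matrix.submatrix_apply]
      have : famIX k (3 ^ e) A (Fin.last 3) j.castSucc = 0 := by
        fin_cases j <;> simp [famIX]
      rw [this, zero_smul, add_zero]

theorem actsBy_blockDiag4 {e : ℕ} (hρ : IsRegularMap (fun A => ρ A)) (hV : Module.finrank k V = 4)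
    {v : ℕ → V} {ξ : ℕ → Module.Dual k V} (hv : IsEquivariantForm ρ (3 ^ e) v)
    (hξ : IsEquivariantForm (transposeDual ρ) (3 ^ e) ξ)
    (hp : ∀ i ≤ 3 ^ e, ∀ j ≤ 3 ^ e, ξ i (v j) = if i = j then ((3 ^ e).choose j : k) else 0)
    (hvz : ∀ j, 0 < j → j < 3 ^ e → v j = 0) (hξz : ∀ j, 0 < j → j < 3 ^ e → ξ j = 0) :
    ∃ (i : Idx14) (b : Fin 4 → V), ActsBy ρ b (list14 3 i) := by
  have hpos : 0 < 3 ^ e := by positivity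
  obtain ⟨hv0, hξ0⟩ := ne_zero_of_pairing hp (Nat.zero_le _) (by simp)
  have hle : ∀ i, ![0, 3 ^ e] i ≤ 3 ^ e := by simp [Fin.forall_fin_two]
  have hinj := injective_vec_two hpos.ne
  have hact := hv.actsBy_entryPow hv0 hvz
  have hK := hξ.ker_invariant hle (fun j hj hj' => hξz j
    (Nat.pos_of_ne_zero (hj' 0).symm) (lt_of_le_of_ne hj (hj' 1).symm))
  set φ : Fin 2 → Module.Dual k V := fun i => ξ (![0, 3 ^ e] i) with hφ
  have hpair : ∀ i j, φ i (![v 0, v (3 ^ e)] j) = if i = j then (1 : k) else 0 := by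
    intro i j
    have h1 : ![v 0, v (3 ^ e)] j = v (![0, 3 ^ e] j) := by fin_cases j <;> rfl
    have h2 : (3 ^ e).choose (![0, 3 ^ e] j) = 1 := by fin_cases j <;> simp
    rw [hφ, h1, hp _ (hle i) _ (hle j), h2]
    simp [hinj.eq_iff]
  have hdim := finrank_ker_pi_add (μ := fun _ => 1) (by simp) hpair
  have hrank : Module.finrank k (LinearMap.ker (LinearMap.pi φ)) = 2 := by omega
  have hli : ∀ c : Fin 2 → LinearMap.ker (LinearMap.pi φ),
      LinearIndependent k (fun i => (c i : V)) →
      LinearIndependent k ![![v 0, v (3 ^ e)] 0, ![v 0, v (3 ^ e)] 1, (c 0 : V), (c 1 : V)] :=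
    fun c hc => linearIndependent_of_dual_pair (c := fun i => (c i : V)) (μ := fun _ => 1)
      (by simp) hpair (fun i j => congrFun (c j).2 i) hc
  rcases classify_finrank_two (hρ.restrictRep hK) hrank with htriv | ⟨f, c, hc⟩
  · obtain ⟨c, hc⟩ := actsBy_one_of_eq_one hrank htriv
    exact ⟨Idx14.XXIV e, _, hact.blockDiag4 hc.subtype (hli c hc.subtype.1)⟩
  · rcases le_total f e with hfe | hef
    · exact ⟨Idx14.XV e f hfe, _, hact.blockDiag4 hc.subtype (hli c hc.subtype.1)⟩
    · exact ⟨Idx14.XV f e hef, _, hc.subtype.blockDiag4 hact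
        (linearIndependent_swap (c := fun i => (c i : V)) (hli c hc.subtype.1))⟩

/-- Every four-dimensional representation occurs in the list. -/
theorem classify_finrank_four (hρ : IsRegularMap (fun A => ρ A)) (hV : Module.finrank k V = 4) :
    ∃ (i : Idx14) (b : Fin 4 → V), ActsBy ρ b (list14 3 i) := by
  have : Nontrivial V := Module.nontrivial_of_finrank_pos (R := k) (by omega)
  obtain ⟨m, v, ξ, hv, hξ, hp, htriv⟩ := exists_highestWeight hρ
  have hcount := chooseCountLE_finrank hv hp
  rw [hV] at hcount
  obtain ⟨hv0, hξ0⟩ := ne_zero_of_pairing hp (Nat.zero_le _) (by simp)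
  rcases hcount.classify_four with h0 | ⟨e, rfl⟩ | ⟨e, rfl⟩ | ⟨e, f, hef, rfl⟩
  · exact ⟨Idx14.XXVI, actsBy_one_of_eq_one hV (htriv h0)⟩
  · by_cases hvz : ∀ j, 0 < j → j < 3 ^ e → v j = 0
    · by_cases hξz : ∀ j, 0 < j → j < 3 ^ e → ξ j = 0
      · exact actsBy_blockDiag4 hρ hV hv hξ hp hvz hξz
      · push Not at hξz
        obtain ⟨j, hj, hj', hξj⟩ := hξz
        obtain ⟨f, rfl, h1, h2⟩ := hξ.exists_of_interior (by rw [Subspace.dual_finrank_eq, hV])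
          hξ0 hj hj' hξj
        exact ⟨Idx14.II f, actsBy_famII hV hξ hξ0 h1 h2⟩
    · push Not at hvz
      obtain ⟨j, hj, hj', hvj⟩ := hvz
      obtain ⟨f, rfl, h1, h2⟩ := hv.exists_of_interior hV.le hv0 hj hj' hvj
      exact ⟨Idx14.VII f, actsBy_famVII hV hv hv0 h1 h2⟩
  · exact ⟨Idx14.IX e, actsBy_famIX hρ hV hv hξ hp⟩
  · exact ⟨Idx14.IV e f hef, actsBy_kron4 hV hef hv hp⟩

end FinrankFour

section MatrixEquivalence
variable {k : Type*} [Field k]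

theorem MatEquiv.symm {f g : SpecialLinearGroup (Fin 2) k → Matrix (Fin 4) (Fin 4) k}
    (h : MatEquiv f g) : MatEquiv g f := by
  obtain ⟨P, hP⟩ := h
  refine ⟨P⁻¹, fun A => ?_⟩
  rw [← hP, inv_inv, Matrix.mul_assoc, Matrix.mul_assoc, Matrix.mul_assoc, Units.mul_inv, mul_one,
    ← Matrix.mul_assoc, Units.mul_inv, one_mul]

theorem MatEquiv.trans {f g h : SpecialLinearGroup (Fin 2) k → Matrix (Fin 4) (Fin 4) k}
    (hfg : MatEquiv f g) (hgh : MatEquiv g h) : MatEquiv f h := by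
  obtain ⟨P, hP⟩ := hfg
  obtain ⟨Q, hQ⟩ := hgh
  refine ⟨P * Q, fun A => ?_⟩
  rw [← hQ, ← hP, _root_.mul_inv_rev]
  simp only [Units.val_mul, Matrix.mul_assoc]

theorem MatEquiv.trace_eq {f g : SpecialLinearGroup (Fin 2) k → Matrix (Fin 4) (Fin 4) k}
    (h : MatEquiv f g) (A : SpecialLinearGroup (Fin 2) k) : (f A).trace = (g A).trace := by
  obtain ⟨P, hP⟩ := h
  rw [← hP, Matrix.trace_mul_comm, ← Matrix.mul_assoc, Units.mul_inv, one_mul]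

theorem MatEquiv.exists_det_ne_zero {f g : SpecialLinearGroup (Fin 2) k → Matrix (Fin 4) (Fin 4) k}
    (h : MatEquiv f g) :
    ∃ P : Matrix (Fin 4) (Fin 4) k, P.det ≠ 0 ∧ ∀ A, f A * P = P * g A := by
  obtain ⟨P, hP⟩ := h
  refine ⟨P, ((Matrix.isUnit_iff_isUnit_det _).1 P.isUnit).ne_zero, fun A => ?_⟩
  rw [← hP, ← Matrix.mul_assoc, ← Matrix.mul_assoc, Units.mul_inv, one_mul]

/-- The linear representation on `k⁴` attached to a homomorphism into `SL(4,k)`. -/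
noncomputable def standardRep
    (σ : SpecialLinearGroup (Fin 2) k →* SpecialLinearGroup (Fin 4) k) :
    SpecialLinearGroup (Fin 2) k →* Module.End k (Fin 4 → k) where
  toFun A := Matrix.toLin' (σ A).1
  map_one' := by simp [Module.End.one_eq_id]
  map_mul' A B := by simp [Matrix.toLin'_mul, Module.End.mul_eq_comp]

theorem isRegularMap_standardRep {σ : SpecialLinearGroup (Fin 2) k →* SpecialLinearGroup (Fin 4) k}
    (hσ : IsPolyEntries fun A => (σ A).1) : IsRegularMap fun A => standardRep σ A := by
  choose P hP using hσ
  refine ⟨Fin 4 × Fin 4, inferInstance, fun z => P z.1 z.2,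
    fun z => Matrix.toLin' (Matrix.single z.1 z.2 1), fun A => ?_⟩
  change Matrix.toLin' (σ A).1 = _
  conv_lhs => rw [Matrix.matrix_eq_sum_single (σ A).1]
  rw [map_sum, Fintype.sum_prod_type]
  refine Finset.sum_congr rfl fun i _ => ?_
  rw [map_sum]
  refine Finset.sum_congr rfl fun j _ => ?_
  rw [← hP, ← map_smul, Matrix.smul_single, smul_eq_mul, mul_one]

theorem ActsBy.matEquiv {σ : SpecialLinearGroup (Fin 2) k →* SpecialLinearGroup (Fin 4) k}
    {b : Fin 4 → Fin 4 → k} {T : SpecialLinearGroup (Fin 2) k → Matrix (Fin 4) (Fin 4) k}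
    (h : ActsBy (standardRep σ) b T) : MatEquiv (fun A => (σ A).1) T := by
  obtain ⟨hb, hT⟩ := h
  have hunit : IsUnit (Matrix.of b)ᵀ := by
    rw [← Matrix.linearIndependent_cols_iff_isUnit]
    exact hb
  obtain ⟨P, hP⟩ := hunit
  refine ⟨P, fun A => ?_⟩
  have hcomm : (σ A).1 * (P : Matrix (Fin 4) (Fin 4) k) = P * T A := by
    ext i j
    have := congrFun (hT A j) i
    change ((σ A).1 *ᵥ b j) i = _ at this
    rw [hP, Matrix.mul_apply, Matrix.mul_apply]
    simpa [Matrix.mulVec, dotProduct, mul_comm] using this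
  rw [Matrix.mul_assoc, hcomm, ← Matrix.mul_assoc, Units.inv_mul, one_mul]

theorem exists_matEquiv_list14 [Infinite k] [CharP k 3]
    (σ : SpecialLinearGroup (Fin 2) k →* SpecialLinearGroup (Fin 4) k)
    (hσ : IsPolyEntries fun A => (σ A).1) :
    ∃ i : Idx14, MatEquiv (fun A => (σ A).1) (list14 3 i) := by
  obtain ⟨i, b, hb⟩ := classify_finrank_four (isRegularMap_standardRep hσ) (by simp)
  exact ⟨i, hb.matEquiv⟩

end MatrixEquivalence

section Inequivalence
variable {k : Type*} [Field k]

theorem le_of_trace_weights_eq [Infinite k] [CharP k 3] {m n m' n' : ℕ} (hnm : n ≤ m)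
    (hnm' : n' ≤ m')
    (h : ∀ t : k, t ≠ 0 → t ^ m + t⁻¹ ^ m + t ^ n + t⁻¹ ^ n =
      t ^ m' + t⁻¹ ^ m' + t ^ n' + t⁻¹ ^ n') : m ≤ m' := by
  by_contra! hlt
  have hinv : ∀ t : k, t ≠ 0 → ∀ j ≤ m, t ^ m * t⁻¹ ^ j = t ^ (m - j) := by
    intro t ht j hj
    rw [inv_pow, pow_sub₀ _ ht hj]
  have key := sum_filter_eq_of_pow_smul_eq (k := k) (V := k) Finset.univ Finset.univ
    ![m + m, m - m, m + n, m - n] ![m + m', m - m', m + n', m - n'] (fun _ => 1) (fun _ => 1)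
    (fun t ht => by
      have := congrArg (t ^ m * ·) (h t ht)
      simp only [mul_add, ← pow_add, hinv t ht m le_rfl, hinv t ht n hnm, hinv t ht m' hlt.le,
        hinv t ht n' (hnm'.trans hlt.le)] at this
      simpa [Fin.sum_univ_four] using this) (m + m)
  simp only [Finset.sum_filter, Fin.sum_univ_four] at key
  simp [show 0 ≠ m + m by omega, show ¬ m - n = m + m by omega, hlt.ne, show n' ≠ m by omega,
    show ¬ m - m' = m + m by omega, show ¬ m - n' = m + m by omega] at key
  split_ifs at key
  · exact two_ne_zero_of_charP_three (k := k) (by rw [← one_add_one_eq_two]; exact key)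
  · simp at key

theorem le_of_add_inv_pow_eq [Infinite k] {n n' : ℕ}
    (h : ∀ t : k, t ≠ 0 → t ^ n + t⁻¹ ^ n = t ^ n' + t⁻¹ ^ n') : n ≤ n' := by
  by_contra! hlt
  have hinv : ∀ t : k, t ≠ 0 → ∀ j ≤ n, t ^ n * t⁻¹ ^ j = t ^ (n - j) := by
    intro t ht j hj
    rw [inv_pow, pow_sub₀ _ ht hj]
  have key := sum_filter_eq_of_pow_smul_eq (k := k) (V := k) Finset.univ Finset.univ
    ![n + n, n - n] ![n + n', n - n'] (fun _ => 1) (fun _ => 1)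
    (fun t ht => by
      have := congrArg (t ^ n * ·) (h t ht)
      simp only [mul_add, ← pow_add, hinv t ht n le_rfl, hinv t ht n' hlt.le] at this
      simpa [Fin.sum_univ_two] using this) (n + n)
  simp only [Finset.sum_filter, Fin.sum_univ_two] at key
  simp [show 0 ≠ n + n by omega, hlt.ne, show ¬ n - n' = n + n by omega] at key

theorem trace_weights_unique [Infinite k] [CharP k 3] {m n m' n' : ℕ} (hnm : n ≤ m)
    (hnm' : n' ≤ m')
    (h : ∀ t : k, t ≠ 0 → t ^ m + t⁻¹ ^ m + t ^ n + t⁻¹ ^ n =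
      t ^ m' + t⁻¹ ^ m' + t ^ n' + t⁻¹ ^ n') : m = m' ∧ n = n' := by
  obtain rfl : m = m' := le_antisymm (le_of_trace_weights_eq hnm hnm' h)
    (le_of_trace_weights_eq hnm' hnm fun t ht => (h t ht).symm)
  have h' : ∀ t : k, t ≠ 0 → t ^ n + t⁻¹ ^ n = t ^ n' + t⁻¹ ^ n' := fun t ht => by
    linear_combination h t ht
  exact ⟨rfl, le_antisymm (le_of_add_inv_pow_eq h')
    (le_of_add_inv_pow_eq fun t ht => (h' t ht).symm)⟩

/-- The nonnegative torus weights `m ≥ n` of a member of the list; the full set of weights is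
`±m, ±n`. -/
def torusWeights : Idx14 → ℕ × ℕ
  | .II e => (3 * 3 ^ e, 3 ^ e)
  | .IV e₁ e₂ _ => (3 ^ e₂ + 3 ^ e₁, 3 ^ e₂ - 3 ^ e₁)
  | .VII e => (3 * 3 ^ e, 3 ^ e)
  | .IX e => (2 * 3 ^ e, 0)
  | .XV e₂ e₃ _ => (3 ^ e₂, 3 ^ e₃)
  | .XXIV e => (3 ^ e, 0)
  | .XXVI => (0, 0)

theorem torusWeights_le (i : Idx14) : (torusWeights i).2 ≤ (torusWeights i).1 := by
  cases i with
  | IV e₁ e₂ h => exact (Nat.sub_le _ _).trans (Nat.le_add_right _ _)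
  | XV e₂ e₃ h => exact Nat.pow_le_pow_right (by norm_num) h
  | _ => simp [torusWeights]

theorem trace_list14_torusSL (i : Idx14) (t : k) (ht : t ≠ 0) :
    (list14 3 i (torusSL t ht)).trace =
      t ^ (torusWeights i).1 + t⁻¹ ^ (torusWeights i).1 +
        t ^ (torusWeights i).2 + t⁻¹ ^ (torusWeights i).2 := by
  cases i with
  | II e => simp [list14, famII, torusWeights, Matrix.trace, Fin.sum_univ_four, torusSL_val]
  | IV e₁ e₂ h =>
    have hle : 3 ^ e₁ ≤ 3 ^ e₂ := Nat.pow_le_pow_right (by norm_num) h.le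
    simp only [torusWeights, pow_add, inv_pow, pow_sub₀ _ ht hle]
    simp [list14, kron4, entryPow, Matrix.trace, Fin.sum_univ_four, torusSL_val]
    ring
  | VII e =>
    simp [list14, famVII, torusWeights, Matrix.trace, Fin.sum_univ_four, torusSL_val]
    ring
  | IX e =>
    simp [list14, famIX, torusWeights, Matrix.trace, Fin.sum_univ_four, torusSL_val, ht]
    ring
  | XV e₂ e₃ h =>
    simp [list14, blockDiag4, entryPow, torusWeights, Matrix.trace, Fin.sum_univ_four, torusSL_val]
  | XXIV e =>
    simp [list14, blockDiag4, entryPow, torusWeights, Matrix.trace, Fin.sum_univ_four, torusSL_val]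
  | XXVI =>
    simp [list14, torusWeights]
    norm_num

theorem torusWeights_eq_of_matEquiv [Infinite k] [CharP k 3] {i j : Idx14}
    (h : MatEquiv (list14 (k := k) 3 i) (list14 3 j)) : torusWeights i = torusWeights j := by
  have := trace_weights_unique (k := k) (torusWeights_le i) (torusWeights_le j) fun t ht => by
    rw [← trace_list14_torusSL i t ht, ← trace_list14_torusSL j t ht, h.trace_eq]
  exact Prod.ext this.1 this.2

theorem MatEquiv.sub_one_mul_self_eq_zero
    {f g : SpecialLinearGroup (Fin 2) k → Matrix (Fin 4) (Fin 4) k} (h : MatEquiv f g)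
    {A : SpecialLinearGroup (Fin 2) k} (hA : (f A - 1) * (f A - 1) = 0) :
    (g A - 1) * (g A - 1) = 0 := by
  obtain ⟨P, hP⟩ := h
  have hg : g A - 1 = (P⁻¹ : GL (Fin 4) k) * (f A - 1) * (P : Matrix (Fin 4) (Fin 4) k) := by
    rw [← hP, mul_sub, sub_mul, mul_one, Units.inv_mul]
  calc (g A - 1) * (g A - 1) = (P⁻¹ : GL (Fin 4) k) * (f A - 1) *
        ((P : Matrix (Fin 4) (Fin 4) k) * (P⁻¹ : GL (Fin 4) k)) * (f A - 1) * P := by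
        rw [hg]; simp only [Matrix.mul_assoc]
    _ = (P⁻¹ : GL (Fin 4) k) * ((f A - 1) * (f A - 1)) * P := by
        rw [Units.mul_inv, mul_one]; simp only [Matrix.mul_assoc]
    _ = 0 := by rw [hA, Matrix.mul_zero, Matrix.zero_mul]

theorem blockDiag4_upperSL_sub_one_mul_self (m n : ℕ) (hm : m ≠ 0) (hn : n ≠ 0) :
    (blockDiag4 (entryPow (upperSL (1 : k)).1 m) (entryPow (upperSL (1 : k)).1 n) - 1) *
      (blockDiag4 (entryPow (upperSL (1 : k)).1 m) (entryPow (upperSL (1 : k)).1 n) - 1) = 0 := by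
  ext i j
  rw [Matrix.mul_apply, Fin.sum_univ_four]
  fin_cases i <;> fin_cases j <;> simp [blockDiag4, entryPow, upperSL_val, hm, hn]

theorem famII_upperSL_sub_one_mul_self_ne (q : ℕ) (hq : q ≠ 0) :
    (famII k q (upperSL 1) - 1) * (famII k q (upperSL 1) - 1) ≠ 0 := by
  intro h
  have := congrFun (congrFun h 0) 3
  rw [Matrix.mul_apply, Fin.sum_univ_four] at this
  simp [famII, upperSL_val, hq] at this

theorem famVII_upperSL_sub_one_mul_self_ne (q : ℕ) (hq : q ≠ 0) :
    (famVII k q (upperSL 1) - 1) * (famVII k q (upperSL 1) - 1) ≠ 0 := by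
  intro h
  have := congrFun (congrFun h 0) 3
  rw [Matrix.mul_apply, Fin.sum_univ_four] at this
  simp [famVII, upperSL_val, hq] at this

theorem det_eq_zero_of_two_rows {P : Matrix (Fin 4) (Fin 4) k}
    (h₁ : P 1 0 = 0 ∧ P 1 1 = 0 ∧ P 1 2 = 0) (h₃ : P 3 0 = 0 ∧ P 3 1 = 0 ∧ P 3 2 = 0) :
    P.det = 0 := by
  obtain ⟨h10, h11, h12⟩ := h₁
  obtain ⟨h30, h31, h32⟩ := h₃
  simp [Matrix.det_succ_row_zero, Fin.sum_univ_succ, Fin.succAbove, h10, h11, h12, h30, h31, h32]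

theorem not_matEquiv_famII_famVII [Infinite k] (q : ℕ) (hq : 0 < q) :
    ¬ MatEquiv (famII k q) (famVII k q) := by
  intro h
  obtain ⟨P, hdet, hP⟩ := h.exists_det_ne_zero
  have hrow : ∀ i, (∀ s : k, (famII k q (upperSL s) * P) i = P i) →
      P i 0 = 0 ∧ P i 1 = 0 ∧ P i 2 = 0 := by
    intro i hi
    have hcol : ∀ (s : k) (j : Fin 4), (P * famVII k q (upperSL s)) i j = P i j := fun s j => by
      rw [← hP, hi]
    have h0 : P i 0 = 0 := by
      have := hcol 1 1
      rw [Matrix.mul_apply, Fin.sum_univ_four] at this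
      simpa [famVII, upperSL_val, hq.ne'] using this
    have hsum : ∀ s : k, s ≠ 0 →
        ∑ l : Fin 2, s ^ (![q, 3 * q] l) • (![P i 1, P i 2] : Fin 2 → k) l = 0 := by
      intro s _
      have := hcol s 3
      rw [Matrix.mul_apply, Fin.sum_univ_four] at this
      simp [famVII, upperSL_val, hq.ne', h0] at this
      rw [Fin.sum_univ_two]
      simpa [mul_comm] using this
    have hinj : Function.Injective ![q, 3 * q] := injective_vec_two (by omega)
    exact ⟨h0, eq_zero_of_sum_pow_smul_eq_zero hinj.injOn hsum (Finset.mem_univ 0),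
      eq_zero_of_sum_pow_smul_eq_zero hinj.injOn hsum (Finset.mem_univ 1)⟩
  refine hdet (det_eq_zero_of_two_rows (hrow 1 fun s => ?_) (hrow 3 fun s => ?_)) <;>
  · ext j
    rw [Matrix.mul_apply, Fin.sum_univ_four]
    simp [famII, upperSL_val, hq.ne']

theorem eq_or_of_torusWeights_eq {i j : Idx14} (h : torusWeights i = torusWeights j) :
    i = j ∨ ∃ e, (i = .II e ∨ i = .VII e ∨ i = .XV (e + 1) e (Nat.le_succ e)) ∧
      (j = .II e ∨ j = .VII e ∨ j = .XV (e + 1) e (Nat.le_succ e)) := by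
  have hinj : ∀ {a b : ℕ}, 3 ^ a = 3 ^ b → a = b := fun h => Nat.pow_right_injective (by norm_num) h
  have hodd : ∀ e : ℕ, 3 ^ e % 2 = 1 := fun e => by
    rw [Nat.pow_mod]; simp
  have hlt : ∀ {a b : ℕ}, a < b → 3 ^ a < 3 ^ b := fun h => Nat.pow_lt_pow_right (by norm_num) h
  have hsucc : ∀ a : ℕ, 3 * 3 ^ a = 3 ^ (a + 1) := fun a => by rw [pow_succ, mul_comm]
  rcases i with a | ⟨b, a, hi⟩ | a | a | ⟨a, b, hi⟩ | a | _ <;>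
    rcases j with c | ⟨d, c, hj⟩ | c | c | ⟨c, d, hj⟩ | c | _ <;>
    simp only [torusWeights, Prod.mk.injEq] at h <;>
    obtain ⟨h₁, h₂⟩ := h <;>
    try have ha := hodd a
  all_goals try have hb := hodd b
  all_goals try have hc := hodd c
  all_goals try have hd := hodd d
  all_goals try have hi' := hlt hi
  all_goals try have hj' := hlt hj
  all_goals try (exfalso; omega)
  · obtain rfl := hinj h₂
    exact .inl rfl
  · obtain rfl := hinj h₂
    simp
  · obtain rfl := hinj h₂
    obtain rfl := hinj ((hsucc a).symm.trans h₁)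
    simp
  · obtain rfl : a = c := hinj (by omega)
    obtain rfl : b = d := hinj (by omega)
    exact .inl rfl
  · obtain rfl := hinj h₂
    simp
  · obtain rfl := hinj h₂
    exact .inl rfl
  · obtain rfl := hinj h₂
    obtain rfl := hinj ((hsucc a).symm.trans h₁)
    simp
  · obtain rfl : a = c := hinj (by omega)
    exact .inl rfl
  · obtain rfl := hinj h₂
    obtain rfl := hinj (h₁.trans (hsucc b))
    simp
  · obtain rfl := hinj h₂
    obtain rfl := hinj (h₁.trans (hsucc b))
    simp
  · obtain rfl := hinj h₁
    obtain rfl := hinj h₂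
    exact .inl rfl
  · obtain rfl := hinj h₁
    exact .inl rfl
  · exact .inl rfl

theorem eq_of_matEquiv_list14 [Infinite k] [CharP k 3] {i j : Idx14}
    (h : MatEquiv (list14 (k := k) 3 i) (list14 3 j)) : i = j := by
  have h0 : ∀ e : ℕ, 3 ^ e ≠ 0 := fun e => by positivity
  have hXV : ∀ e : ℕ, (list14 (k := k) 3 (.XV (e + 1) e (Nat.le_succ e)) (upperSL 1) - 1) *
      (list14 3 (.XV (e + 1) e (Nat.le_succ e)) (upperSL 1) - 1) = 0 := fun e =>
    blockDiag4_upperSL_sub_one_mul_self _ _ (h0 _) (h0 _)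
  rcases eq_or_of_torusWeights_eq (torusWeights_eq_of_matEquiv h) with hij | ⟨e, hi, hj⟩
  · exact hij
  rcases hi with rfl | rfl | rfl <;> rcases hj with rfl | rfl | rfl
  · rfl
  · exact (not_matEquiv_famII_famVII _ (by positivity) h).elim
  · exact (famII_upperSL_sub_one_mul_self_ne _ (h0 e)
      (h.symm.sub_one_mul_self_eq_zero (hXV e))).elim
  · exact (not_matEquiv_famII_famVII _ (by positivity) h.symm).elim
  · rfl
  · exact (famVII_upperSL_sub_one_mul_self_ne _ (h0 e)
      (h.symm.sub_one_mul_self_eq_zero (hXV e))).elim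
  · exact (famII_upperSL_sub_one_mul_self_ne _ (h0 e) (h.sub_one_mul_self_eq_zero (hXV e))).elim
  · exact (famVII_upperSL_sub_one_mul_self_ne _ (h0 e) (h.sub_one_mul_self_eq_zero (hXV e))).elim
  · rfl

end Inequivalence

/-- For `p = 3`, every homomorphism of algebraic groups
`σ : SL(2,k) → SL(4,k)` is equivalent to exactly one member of the list (II), (IV), (VII),
(IX), (XV), (XXIV), (XXVI); in particular distinct members of the list are inequivalent. -/
theorem stmt14 {k : Type*} [Field k] [IsAlgClosed k] {p : ℕ} [Fact p.Prime] [CharP k p]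
    (hp : p = 3) :
    (∀ σ : SpecialLinearGroup (Fin 2) k →* SpecialLinearGroup (Fin 4) k,
        IsPolyEntries (fun A => (σ A).1) →
          ∃! i : Idx14, MatEquiv (fun A => (σ A).1) (list14 p i)) ∧
      ∀ i j : Idx14, MatEquiv (list14 (k := k) p i) (list14 (k := k) p j) → i = j := by
  subst hp
  refine ⟨fun σ hσ => ?_, fun i j h => eq_of_matEquiv_list14 h⟩
  obtain ⟨i, hi⟩ := exists_matEquiv_list14 σ hσ
  exact ⟨i, hi, fun j hj => eq_of_matEquiv_list14 (MatEquiv.trans (MatEquiv.symm hj) hi)⟩
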